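/- arXiv:1905.08121 — 2 statements merged into one kernel-verified Lean document; each statement's English description precedes it below -/
import Mathlib

section
/- Let n ≥ 1, 1 < p < ∞, 0 < q < p−1, 0 < α < n/p, and n(p−1)/(n−αp) < r < ∞. Then there exist constants 0 < c ≤ C, depending only on α, p, q, r, n, such that for every locally finite nonnegative Borel measure σ on ℝⁿ, c·∫_{ℝⁿ} sup_{ρ>0} ( κ(B(x,ρ))^{q(p−1)/(p−1−q)} / ρ^{n−αp} )^{r/(p−1)} dx ≤ ∫_{ℝⁿ} ( K_{α,p,q}σ(x) )^{r} dx ≤ C·∫_{ℝⁿ} sup_{ρ>0} ( κ(B(x,ρ))^{q(p−1)/(p−1−q)} / ρ^{n−αp} )^{r/(p−1)} dx. -/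
open MeasureTheory Metric Set
open scoped ENNReal NNReal

/-- The Wolff potential `W_{α,p}ν(x) = ∫₀^∞ (ν(B(x,ρ))/ρ^{n−αp})^{1/(p−1)} dρ/ρ`. -/
noncomputable def wolffPot (n : ℕ) (α p : ℝ)
    (ν : Measure (EuclideanSpace ℝ (Fin n))) (x : EuclideanSpace ℝ (Fin n)) : ℝ≥0∞ :=
  ∫⁻ ρ in Set.Ioi (0 : ℝ),
    (ν (Metric.ball x ρ) / ENNReal.ofReal (ρ ^ ((n : ℝ) - α * p))) ^ (1 / (p - 1)) /
      ENNReal.ofReal ρ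

/-- The least constant `κ(E)` such that
`(∫_E (W_{α,p}ν)^q dσ)^{1/q} ≤ κ · ν(ℝⁿ)^{1/(p−1)}` for all finite measures `ν`. -/
noncomputable def embC (n : ℕ) (α p q : ℝ) (σ : Measure (EuclideanSpace ℝ (Fin n)))
    (E : Set (EuclideanSpace ℝ (Fin n))) : ℝ≥0∞ :=
  sInf {κ : ℝ≥0∞ | ∀ ν : Measure (EuclideanSpace ℝ (Fin n)), IsFiniteMeasure ν →
    (∫⁻ y in E, wolffPot n α p ν y ^ q ∂σ) ^ (1 / q) ≤ κ * (ν Set.univ) ^ (1 / (p - 1))}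

/-- The intrinsic potential of Wolff type
`K_{α,p,q}σ(x) = ∫₀^∞ (κ(B(x,ρ))^{q(p−1)/(p−1−q)}/ρ^{n−αp})^{1/(p−1)} dρ/ρ`. -/
noncomputable def intK (n : ℕ) (α p q : ℝ) (σ : Measure (EuclideanSpace ℝ (Fin n)))
    (x : EuclideanSpace ℝ (Fin n)) : ℝ≥0∞ :=
  ∫⁻ ρ in Set.Ioi (0 : ℝ),
    (embC n α p q σ (Metric.ball x ρ) ^ (q * (p - 1) / (p - 1 - q)) /
      ENNReal.ofReal (ρ ^ ((n : ℝ) - α * p))) ^ (1 / (p - 1)) / ENNReal.ofReal ρ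

lemma ENNReal.add_le_of_forall_lt {a b c : ℝ≥0∞} (ha : a ≠ 0) (hb : b ≠ 0)
    (h : ∀ a' < a, ∀ b' < b, a' + b' ≤ c) : a + b ≤ c := by
  have h1 : ∀ a' < a, a' + b ≤ c := by
    intro a' ha'
    have hle : a' ≤ c := le_self_add.trans (h a' ha' 0 (pos_iff_ne_zero.2 hb))
    refine add_le_of_le_tsub_left_of_le hle (le_of_forall_lt_imp_le_of_dense fun b' hb' => ?_)
    exact ENNReal.le_sub_of_add_le_left ha'.ne_top (h a' ha' b' hb')
  have hbc : b ≤ c := by simpa using h1 0 (pos_iff_ne_zero.2 ha)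
  by_cases hbt : b = ∞
  · rw [show c = ∞ from top_le_iff.1 (hbt ▸ hbc)]
    exact le_top
  refine add_le_of_le_tsub_right_of_le hbc (le_of_forall_lt_imp_le_of_dense fun a' ha' => ?_)
  exact ENNReal.le_sub_of_add_le_right hbt (h1 a' ha')

section Embedding

variable {n : ℕ} {α p q : ℝ}

lemma wolffPot_mono {μ ν : Measure (EuclideanSpace ℝ (Fin n))} (hp : 1 < p) (h : μ ≤ ν)
    (x : EuclideanSpace ℝ (Fin n)) : wolffPot n α p μ x ≤ wolffPot n α p ν x := by
  have hs : 0 ≤ 1 / (p - 1) := one_div_nonneg.2 (by linarith)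
  unfold wolffPot
  gcongr with ρ

lemma wolffPot_smul (hp : 1 < p) {c : ℝ≥0∞} (hc : c ≠ ∞)
    (μ : Measure (EuclideanSpace ℝ (Fin n))) (x : EuclideanSpace ℝ (Fin n)) :
    wolffPot n α p (c • μ) x = c ^ (1 / (p - 1)) * wolffPot n α p μ x := by
  have hs : 0 ≤ 1 / (p - 1) := one_div_nonneg.2 (by linarith)
  unfold wolffPot
  rw [← lintegral_const_mul' _ _ (ENNReal.rpow_ne_top_of_nonneg hs hc)]
  congr 1 with ρ
  rw [Measure.smul_apply, smul_eq_mul, mul_div_assoc, ENNReal.mul_rpow_of_nonneg _ _ hs,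
    mul_div_assoc]

lemma wolffPot_zero (hp : 1 < p) (x : EuclideanSpace ℝ (Fin n)) :
    wolffPot n α p 0 x = 0 := by
  have hs : 0 < 1 / (p - 1) := one_div_pos.2 (by linarith)
  simp [wolffPot, ENNReal.zero_rpow_of_pos (by simpa using hs : 0 < (p - 1)⁻¹)]

/-- The embedding functional is bounded by its least constant. -/
lemma lintegral_wolffPot_le_embC (hp : 1 < p)
    (σ : Measure (EuclideanSpace ℝ (Fin n))) (E : Set (EuclideanSpace ℝ (Fin n)))
    (ν : Measure (EuclideanSpace ℝ (Fin n))) [IsFiniteMeasure ν] (h0 : ν univ ≠ 0) :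
    (∫⁻ y in E, wolffPot n α p ν y ^ q ∂σ) ^ (1 / q) ≤
      embC n α p q σ E * (ν univ) ^ (1 / (p - 1)) := by
  have hs : 0 < 1 / (p - 1) := one_div_pos.2 (by linarith)
  have h1 : ν univ ^ (1 / (p - 1)) ≠ 0 := by
    simp [ENNReal.rpow_eq_zero_iff, h0, measure_ne_top]
  have h2 : ν univ ^ (1 / (p - 1)) ≠ ∞ :=
    ENNReal.rpow_ne_top_of_nonneg hs.le (measure_ne_top _ _)
  rw [← ENNReal.div_le_iff h1 h2]
  refine le_sInf fun κ hκ => ?_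
  rw [ENNReal.div_le_iff h1 h2]
  exact hκ ν inferInstance

/-- Near-extremal probability measures for the least constant. -/
lemma exists_lt_of_lt_embC (hp : 1 < p) (hq : 0 < q)
    {σ : Measure (EuclideanSpace ℝ (Fin n))} {E : Set (EuclideanSpace ℝ (Fin n))} {k : ℝ≥0∞}
    (hk : k < embC n α p q σ E) :
    ∃ μ : Measure (EuclideanSpace ℝ (Fin n)), IsProbabilityMeasure μ ∧
      k < (∫⁻ y in E, wolffPot n α p μ y ^ q ∂σ) ^ (1 / q) := by
  have hs : 0 < 1 / (p - 1) := one_div_pos.2 (by linarith)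
  have hnot : k ∉ {κ : ℝ≥0∞ | ∀ ν : Measure (EuclideanSpace ℝ (Fin n)), IsFiniteMeasure ν →
    (∫⁻ y in E, wolffPot n α p ν y ^ q ∂σ) ^ (1 / q) ≤ κ * (ν univ) ^ (1 / (p - 1))} :=
    fun h => absurd (sInf_le h) (not_le.2 hk)
  simp only [mem_ofPred_eq, not_forall, not_le] at hnot
  obtain ⟨ν, hν, hlt⟩ := hnot
  have h0 : ν ≠ 0 := by
    rintro rfl
    simp [wolffPot_zero hp, ENNReal.zero_rpow_of_pos hq,
      ENNReal.zero_rpow_of_pos (inv_pos.2 hq)] at hlt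
  have hu0 : ν univ ≠ 0 := by simpa using h0
  have hut : ν univ ≠ ∞ := measure_ne_top _ _
  have : NeZero ν := ⟨h0⟩
  refine ⟨(ν univ)⁻¹ • ν, inferInstance, ?_⟩
  have hc : (ν univ)⁻¹ ≠ ∞ := ENNReal.inv_ne_top.2 hu0
  simp only [wolffPot_smul hp hc, ENNReal.mul_rpow_of_nonneg _ _ hq.le]
  rw [lintegral_const_mul' _ _
      (ENNReal.rpow_ne_top_of_nonneg hq.le (ENNReal.rpow_ne_top_of_nonneg hs.le hc)),
    ENNReal.mul_rpow_of_nonneg _ _ (by positivity : 0 ≤ 1 / q), ← ENNReal.rpow_mul,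
    mul_one_div_cancel hq.ne', ENNReal.rpow_one, ENNReal.inv_rpow, mul_comm,
    ← div_eq_mul_inv, ENNReal.lt_div_iff_mul_lt]
  · exact hlt
  · left
    simp [ENNReal.rpow_eq_zero_iff, hut, hu0]
  · left
    simp [ENNReal.rpow_eq_top_iff, hut, hu0]

lemma embC_mono (σ : Measure (EuclideanSpace ℝ (Fin n))) (hq : 0 < q)
    {E F : Set (EuclideanSpace ℝ (Fin n))} (h : E ⊆ F) :
    embC n α p q σ E ≤ embC n α p q σ F := by
  refine sInf_le_sInf fun κ hκ ν hν => le_trans ?_ (hκ ν hν)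
  gcongr

/-- Superadditivity of `κ ^ (q(p-1)/(p-1-q))` on disjoint sets. -/
lemma embC_rpow_add_le (hp : 1 < p) (hq : 0 < q) (hqp : q < p - 1)
    (σ : Measure (EuclideanSpace ℝ (Fin n))) {E F : Set (EuclideanSpace ℝ (Fin n))}
    (hF : MeasurableSet F) (hEF : Disjoint E F) :
    embC n α p q σ E ^ (q * (p - 1) / (p - 1 - q)) +
      embC n α p q σ F ^ (q * (p - 1) / (p - 1 - q)) ≤
    embC n α p q σ (E ∪ F) ^ (q * (p - 1) / (p - 1 - q)) := by
  obtain ⟨s, rfl⟩ : ∃ s, p = s + 1 := ⟨p - 1, by ring⟩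
  simp only [add_sub_cancel_right] at hqp ⊢
  have hs : 0 < s := by linarith
  have hsq : 0 < s - q := by linarith
  set m := q * s / (s - q) with hm
  have hm0 : 0 < m := by positivity
  have key : ∀ G : Set (EuclideanSpace ℝ (Fin n)), ∀ a < embC n α (s + 1) q σ G ^ m,
      ∃ μ : Measure (EuclideanSpace ℝ (Fin n)), IsProbabilityMeasure μ ∧
        a ≤ ∫⁻ y in G, wolffPot n α (s + 1) (a • μ) y ^ q ∂σ := by
    intro G a ha
    have h1 : a ^ (1 / m) < embC n α (s + 1) q σ G := by
      rw [← ENNReal.rpow_lt_rpow_iff hm0, ← ENNReal.rpow_mul, one_div_mul_cancel hm0.ne',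
        ENNReal.rpow_one]
      exact ha
    have hat : a ≠ ∞ := ha.ne_top
    obtain ⟨μ, hμ, h2⟩ := exists_lt_of_lt_embC hp hq h1
    refine ⟨μ, hμ, ?_⟩
    simp only [wolffPot_smul hp hat, ENNReal.mul_rpow_of_nonneg _ _ hq.le, add_sub_cancel_right]
    rw [lintegral_const_mul' _ _
      (ENNReal.rpow_ne_top_of_nonneg hq.le (ENNReal.rpow_ne_top_of_nonneg (by positivity) hat))]
    have h3 : a ^ (q / m) ≤ ∫⁻ y in G, wolffPot n α (s + 1) μ y ^ q ∂σ := by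
      have := ENNReal.rpow_le_rpow h2.le hq.le
      rw [← ENNReal.rpow_mul, ← ENNReal.rpow_mul, one_div_mul_cancel hq.ne',
        ENNReal.rpow_one] at this
      convert this using 2
      ring
    calc a = (a ^ (1 / s)) ^ q * a ^ (q / m) := by
          rw [← ENNReal.rpow_mul, ← ENNReal.rpow_add_of_nonneg _ _ (by positivity)
            (by positivity)]
          have : 1 / s * q + q / m = 1 := by
            rw [hm]; field_simp; ring
          rw [this, ENNReal.rpow_one]
      _ ≤ _ := by gcongr
  by_cases hE0 : embC n α (s + 1) q σ E ^ m = 0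
  · rw [hE0, zero_add]
    exact ENNReal.rpow_le_rpow (embC_mono σ hq subset_union_right) hm0.le
  by_cases hF0 : embC n α (s + 1) q σ F ^ m = 0
  · rw [hF0, add_zero]
    exact ENNReal.rpow_le_rpow (embC_mono σ hq subset_union_left) hm0.le
  refine ENNReal.add_le_of_forall_lt hE0 hF0 fun a ha b hb => ?_
  obtain ⟨μ, hμ, h1⟩ := key E a ha
  obtain ⟨ν, hν, h2⟩ := key F b hb
  by_cases h0 : a + b = 0
  · simp [h0]
  have hat : a ≠ ∞ := ha.ne_top
  have hbt : b ≠ ∞ := hb.ne_top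
  have habt : a + b ≠ ∞ := ENNReal.add_ne_top.2 ⟨hat, hbt⟩
  set τ := a • μ + b • ν with hτ
  have hτu : τ univ = a + b := by simp [hτ]
  have : IsFiniteMeasure τ := ⟨by rw [hτu]; exact habt.lt_top⟩
  have h3 : a + b ≤ ∫⁻ y in E ∪ F, wolffPot n α (s + 1) τ y ^ q ∂σ := by
    rw [lintegral_union hF hEF]
    refine add_le_add (h1.trans ?_) (h2.trans ?_)
    · gcongr with y
      exact wolffPot_mono hp (Measure.le_add_right le_rfl) y
    · gcongr with y
      exact wolffPot_mono hp (Measure.le_add_left le_rfl) y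
  have h4 := (ENNReal.rpow_le_rpow h3 (by positivity : 0 ≤ 1 / q)).trans
    (lintegral_wolffPot_le_embC (α := α) hp σ (E ∪ F) τ (by rw [hτu]; exact h0))
  rw [hτu, add_sub_cancel_right, ← ENNReal.div_le_iff (by simp [ENNReal.rpow_eq_zero_iff, h0, habt])
    (by simp [ENNReal.rpow_eq_top_iff, h0, habt]), ← ENNReal.rpow_sub _ _ h0 habt] at h4
  have h5 := ENNReal.rpow_le_rpow h4 hm0.le
  rw [← ENNReal.rpow_mul] at h5
  have : (1 / q - 1 / s) * m = 1 := by rw [hm]; field_simp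
  rwa [this, ENNReal.rpow_one] at h5

lemma embC_rpow_sum_le (hp : 1 < p) (hq : 0 < q) (hqp : q < p - 1)
    (σ : Measure (EuclideanSpace ℝ (Fin n))) {ι : Type*} (S : Finset ι)
    (E : ι → Set (EuclideanSpace ℝ (Fin n))) (hE : ∀ i ∈ S, MeasurableSet (E i))
    (hd : (S : Set ι).PairwiseDisjoint E) :
    ∑ i ∈ S, embC n α p q σ (E i) ^ (q * (p - 1) / (p - 1 - q)) ≤
      embC n α p q σ (⋃ i ∈ S, E i) ^ (q * (p - 1) / (p - 1 - q)) := by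
  classical
  induction S using Finset.induction_on with
  | empty => simp
  | insert i S hi ih =>
    rw [Finset.sum_insert hi, Finset.set_biUnion_insert]
    have hmS : MeasurableSet (⋃ j ∈ S, E j) :=
      S.measurableSet_biUnion fun j hj => hE j (Finset.mem_insert_of_mem hj)
    refine le_trans (add_le_add le_rfl
      (ih (fun j hj => hE j (Finset.mem_insert_of_mem hj))
        (hd.subset (by simp)))) (embC_rpow_add_le hp hq hqp σ hmS ?_)
    simp only [disjoint_iUnion_right]
    intro j hj
    refine hd (by simp) (by simp [hj]) ?_
    rintro rfl
    exact hi hj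

/-- `κ` of a ball depends lower semicontinuously on the center. -/
lemma lowerSemicontinuous_embC_ball (hp : 1 < p) (hq : 0 < q)
    (σ : Measure (EuclideanSpace ℝ (Fin n))) (ρ : ℝ) :
    LowerSemicontinuous fun x => embC n α p q σ (ball x ρ) := by
  intro x k hk
  obtain ⟨μ, hμ, h1⟩ := exists_lt_of_lt_embC hp hq hk
  have hU : ball x ρ = ⋃ j : ℕ, ball x (ρ - 1 / ((j : ℝ) + 1)) := by
    ext y
    simp only [mem_ball, mem_iUnion]
    constructor
    · intro hy
      obtain ⟨j, hj⟩ := exists_nat_one_div_lt (sub_pos.2 hy)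
      exact ⟨j, by linarith⟩
    · rintro ⟨j, hj⟩
      have : (0 : ℝ) < 1 / ((j : ℝ) + 1) := by positivity
      linarith
  have hmono : Monotone fun j : ℕ => ball x (ρ - 1 / ((j : ℝ) + 1)) := by
    intro i j hij
    refine ball_subset_ball ?_
    gcongr
  have h2 : k ^ q < ∫⁻ y in ball x ρ, wolffPot n α p μ y ^ q ∂σ := by
    have := ENNReal.rpow_lt_rpow h1 hq
    rwa [← ENNReal.rpow_mul, one_div_mul_cancel hq.ne', ENNReal.rpow_one] at this
  rw [hU, setLIntegral_iUnion_of_directed _ hmono.directed_le, lt_iSup_iff] at h2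
  obtain ⟨j, hj⟩ := h2
  filter_upwards [ball_mem_nhds x (by positivity : (0 : ℝ) < 1 / ((j : ℝ) + 1))] with y hy
  have h3 : k < (∫⁻ y in ball x (ρ - 1 / ((j : ℝ) + 1)), wolffPot n α p μ y ^ q ∂σ) ^ (1 / q) := by
    rw [← ENNReal.rpow_lt_rpow_iff hq, ← ENNReal.rpow_mul, one_div_mul_cancel hq.ne',
      ENNReal.rpow_one]
    exact hj
  refine h3.trans_le ((lintegral_wolffPot_le_embC hp σ _ μ (by simp)).trans ?_)
  simp only [measure_univ, ENNReal.one_rpow, mul_one]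
  refine embC_mono σ hq (ball_subset_ball' ?_)
  rw [dist_comm]
  rw [mem_ball] at hy
  linarith

end Embedding

section BallAverage

variable {n : ℕ}

lemma exists_int_coord_of_mem_span {c : ℝ} (hc : c ≠ 0)
    {g : EuclideanSpace ℝ (Fin n)}
    (hg : g ∈ Submodule.span ℤ (Set.range ((EuclideanSpace.basisFun (Fin n) ℝ).toBasis.isUnitSMul
      (w := fun _ => c) fun _ => hc.isUnit))) (i : Fin n) : ∃ k : ℤ, g i = k * c := by
  induction hg using Submodule.span_induction with
  | mem x hx =>
    obtain ⟨j, rfl⟩ := hx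
    by_cases h : j = i
    · exact ⟨1, by simp [Module.Basis.isUnitSMul_apply, h]⟩
    · exact ⟨0, by simp [Module.Basis.isUnitSMul_apply, Ne.symm h]⟩
  | zero => exact ⟨0, by simp⟩
  | add x y _ _ hx hy =>
    obtain ⟨k, hk⟩ := hx
    obtain ⟨l, hl⟩ := hy
    exact ⟨k + l, by simp [hk, hl, add_mul]⟩
  | smul a x _ hx =>
    obtain ⟨k, hk⟩ := hx
    exact ⟨a * k, by simp [hk, mul_assoc]⟩

lemma le_norm_of_mem_span {c : ℝ} (hc : 0 < c) {g : EuclideanSpace ℝ (Fin n)}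
    (hg : g ∈ Submodule.span ℤ (Set.range ((EuclideanSpace.basisFun (Fin n) ℝ).toBasis.isUnitSMul
      (w := fun _ => c) fun _ => hc.ne'.isUnit))) (h0 : g ≠ 0) : c ≤ ‖g‖ := by
  obtain ⟨i, hi⟩ : ∃ i, g i ≠ 0 := by
    by_contra! h
    exact h0 (by ext i; simpa using h i)
  obtain ⟨k, hk⟩ := exists_int_coord_of_mem_span hc.ne' hg i
  have hk0 : k ≠ 0 := by
    rintro rfl
    simp at hk
    exact hi hk
  have h1 : (1 : ℝ) ≤ |(k : ℝ)| := by
    exact_mod_cast Int.one_le_abs hk0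
  calc c ≤ |(k : ℝ)| * c := by nlinarith
    _ = ‖g i‖ := by rw [hk, Real.norm_eq_abs, abs_mul, abs_of_pos hc]
    _ ≤ ‖g‖ := PiLp.norm_apply_le g i

/-- For a monotone set function that is superadditive on disjoint balls, the average of its values
on small balls is controlled by its value on a large ball. -/
lemma lintegral_ball_le_of_superadditive (φ : Set (EuclideanSpace ℝ (Fin n)) → ℝ≥0∞)
    (hmono : Monotone φ)
    (hadd : ∀ (S : Finset (EuclideanSpace ℝ (Fin n))) (ρ : ℝ),
      (S : Set (EuclideanSpace ℝ (Fin n))).PairwiseDisjoint (fun x => ball x ρ) →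
        ∑ x ∈ S, φ (ball x ρ) ≤ φ (⋃ x ∈ S, ball x ρ))
    (hmeas : ∀ ρ, Measurable fun x => φ (ball x ρ))
    (z : EuclideanSpace ℝ (Fin n)) {ρ R : ℝ} (hρ : 0 < ρ) (hρR : ρ ≤ R) :
    ∫⁻ x in ball z R, φ (ball x ρ) ≤
      ENNReal.ofReal ((2 * n) ^ n) * volume (closedBall (0 : EuclideanSpace ℝ (Fin n)) 1) *
        ENNReal.ofReal (ρ ^ n) * φ (ball z (2 * R)) := by
  classical
  have h2ρ : 0 < 2 * ρ := by positivity
  set b := (EuclideanSpace.basisFun (Fin n) ℝ).toBasis.isUnitSMul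
      (w := fun _ => 2 * ρ) fun _ => h2ρ.ne'.isUnit with hb
  have hbn : ∀ i, ‖b i‖ = 2 * ρ := by
    intro i
    simp [hb, Module.Basis.isUnitSMul_apply, norm_smul, abs_of_pos hρ]
  set F := (ball z R).indicator fun x => φ (ball x ρ) with hF
  have hFm : Measurable F := (hmeas ρ).indicator measurableSet_ball
  have hD : volume (ZSpan.fundamentalDomain b) ≤ ENNReal.ofReal ((2 * n) ^ n) *
      volume (closedBall (0 : EuclideanSpace ℝ (Fin n)) 1) * ENNReal.ofReal (ρ ^ n) := by
    have hsub : ZSpan.fundamentalDomain b ⊆ closedBall 0 (2 * n * ρ) := by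
      intro x hx
      rw [mem_closedBall_zero_iff]
      have h1 := ZSpan.norm_fract_le b x
      rw [ZSpan.fract_eq_self.2 hx] at h1
      refine h1.trans (le_of_eq ?_)
      simp [hbn]; ring
    refine (measure_mono hsub).trans (le_of_eq ?_)
    rw [Measure.addHaar_closedBall' _ _ (by positivity), finrank_euclideanSpace_fin, mul_pow,
      ENNReal.ofReal_mul (by positivity)]
    ring
  have hsum : ∀ x, ∑' g : Submodule.span ℤ (Set.range b), F (-g +ᵥ x) ≤ φ (ball z (2 * R)) := by
    intro x
    rw [ENNReal.tsum_eq_iSup_sum]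
    refine iSup_le fun S => ?_
    set S' := S.filter fun g : Submodule.span ℤ (Set.range b) => -g +ᵥ x ∈ ball z R with hS'
    have h1 : ∑ g ∈ S, F (-g +ᵥ x) =
        ∑ g ∈ S', φ (ball ((-g : Submodule.span ℤ (Set.range b)) +ᵥ x) ρ) := by
      rw [hS', Finset.sum_filter]
      simp only [hF, indicator_apply]
    have hinj : Function.Injective fun g : Submodule.span ℤ (Set.range b) => -g +ᵥ x := by
      intro g h hgh
      simpa [Submodule.vadd_def] using hgh
    have h2 : ∑ g ∈ S', φ (ball ((-g : Submodule.span ℤ (Set.range b)) +ᵥ x) ρ) =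
        ∑ y ∈ S'.image fun g : Submodule.span ℤ (Set.range b) => -g +ᵥ x, φ (ball y ρ) := by
      rw [Finset.sum_image hinj.injOn]
    rw [h1, h2]
    refine (hadd _ _ ?_).trans (hmono ?_)
    · intro y hy y' hy' hne
      simp only [Finset.coe_image, mem_image] at hy hy'
      obtain ⟨g, -, rfl⟩ := hy
      obtain ⟨h, -, rfl⟩ := hy'
      refine ball_disjoint_ball ?_
      have hgh : (h - g : EuclideanSpace ℝ (Fin n)) ≠ 0 := by
        intro h0
        apply hne
        have : h = g := Subtype.ext (sub_eq_zero.1 h0)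
        rw [this]
      have := le_norm_of_mem_span h2ρ (sub_mem h.2 g.2) hgh
      rw [dist_eq_norm]
      simp only [Submodule.vadd_def, vadd_eq_add, add_sub_add_right_eq_sub, Submodule.coe_neg]
      rw [show -(g : EuclideanSpace ℝ (Fin n)) - -h = h - g by abel]
      linarith
    · refine iUnion₂_subset fun y hy => ?_
      simp only [Finset.mem_image, hS', Finset.mem_filter] at hy
      obtain ⟨g, ⟨-, hg⟩, rfl⟩ := hy
      refine ball_subset_ball' ?_
      rw [mem_ball] at hg
      linarith
  have : VAddInvariantMeasure (Submodule.span ℤ (Set.range b)) (EuclideanSpace ℝ (Fin n)) volume :=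
    inferInstanceAs (VAddInvariantMeasure (Submodule.span ℤ (Set.range b)).toAddSubgroup _ volume)
  calc ∫⁻ x in ball z R, φ (ball x ρ) = ∫⁻ x, F x := by
        rw [hF, lintegral_indicator measurableSet_ball]
    _ = ∑' g : Submodule.span ℤ (Set.range b), ∫⁻ x in ZSpan.fundamentalDomain b, F (-g +ᵥ x) :=
        (ZSpan.isAddFundamentalDomain b volume).lintegral_eq_tsum' F
    _ = ∫⁻ x in ZSpan.fundamentalDomain b, ∑' g : Submodule.span ℤ (Set.range b), F (-g +ᵥ x) := by
        rw [lintegral_tsum]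
        intro g
        exact (hFm.comp (measurable_const_vadd _)).aemeasurable
    _ ≤ ∫⁻ x in ZSpan.fundamentalDomain b, φ (ball z (2 * R)) := lintegral_mono fun x => hsum x
    _ = φ (ball z (2 * R)) * volume (ZSpan.fundamentalDomain b) := setLIntegral_const _ _
    _ ≤ _ := by
        rw [mul_comm]
        gcongr

end BallAverage

section Sequences

lemma Real.add_rpow_le_rpow_add_mul {a b r t : ℝ} (ha : 0 ≤ a) (hb : 0 ≤ b)
    (ht1 : t ≤ 1) (hr : 0 < r) :
    (a + b) ^ r ≤ a ^ r + max r 1 * (b ^ t * (a + b) ^ (r - t)) := by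
  rcases hb.eq_or_lt with rfl | hb
  · have : 0 ≤ max r 1 * ((0 : ℝ) ^ t * (a + 0) ^ (r - t)) := by positivity
    simpa using this
  have hw : 0 < a + b := by positivity
  set w := a + b with hwdef
  have hu0 : 0 < b / w := by positivity
  have hu1 : b / w ≤ 1 := by rw [div_le_one hw]; linarith
  have haw : a / w = 1 + -(b / w) := by field_simp; linarith
  have h1 : 1 - max r 1 * (b / w) ≤ (a / w) ^ r := by
    rw [haw]
    rcases le_total 1 r with h | h
    · have := one_add_mul_self_le_rpow_one_add (s := -(b / w)) (by linarith) h
      rw [max_eq_left h]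
      linarith
    · rw [max_eq_right h]
      have := Real.rpow_le_rpow_of_exponent_ge' (x := 1 + -(b / w)) (by linarith) (by linarith)
        hr.le h
      rw [Real.rpow_one] at this
      linarith
  have h2 : b / w ≤ (b / w) ^ t := by
    have := Real.rpow_le_rpow_of_exponent_ge hu0 hu1 ht1
    rwa [Real.rpow_one] at this
  have h3 : 1 ≤ (a / w) ^ r + max r 1 * (b / w) ^ t := by
    have : max r 1 * (b / w) ≤ max r 1 * (b / w) ^ t := by gcongr
    linarith
  have h4 := mul_le_mul_of_nonneg_right h3 (Real.rpow_nonneg hw.le r)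
  rw [one_mul, add_mul, ← Real.mul_rpow (by positivity) hw.le, div_mul_cancel₀ _ hw.ne',
    Real.div_rpow hb.le hw.le] at h4
  refine h4.trans (le_of_eq ?_)
  rw [Real.rpow_sub hw]
  ring

lemma ENNReal.add_rpow_le_rpow_add_mul {a b : ℝ≥0∞} {r t : ℝ} (ht0 : 0 < t) (ht1 : t ≤ 1)
    (htr : t ≤ r) :
    (a + b) ^ r ≤ a ^ r + ENNReal.ofReal (max r 1) * (b ^ t * (a + b) ^ (r - t)) := by
  have hr : 0 < r := by linarith
  by_cases ha : a = ∞
  · simp [ha, ENNReal.top_rpow_of_pos hr]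
  by_cases hb : b = ∞
  · rcases htr.eq_or_lt with rfl | h
    · simp [hb, ENNReal.top_rpow_of_pos ht0]
    · simp [hb, ENNReal.top_rpow_of_pos ht0, ENNReal.top_rpow_of_pos (sub_pos.2 h)]
  lift a to ℝ≥0 using ha
  lift b to ℝ≥0 using hb
  rw [← ENNReal.ofReal_coe_nnreal (p := a), ← ENNReal.ofReal_coe_nnreal (p := b),
    ← ENNReal.ofReal_add (by positivity) (by positivity),
    ENNReal.ofReal_rpow_of_nonneg (by positivity) hr.le,
    ENNReal.ofReal_rpow_of_nonneg (by positivity) hr.le,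
    ENNReal.ofReal_rpow_of_nonneg (by positivity) ht0.le,
    ENNReal.ofReal_rpow_of_nonneg (by positivity) (sub_nonneg.2 htr),
    ← ENNReal.ofReal_mul (by positivity), ← ENNReal.ofReal_mul (by positivity),
    ← ENNReal.ofReal_add (by positivity) (by positivity)]
  exact ENNReal.ofReal_le_ofReal
    (Real.add_rpow_le_rpow_add_mul a.2 b.2 ht1 hr)

/-- The `r`-th power of a partial sum is controlled by a discrete integration by parts. -/
lemma rpow_sum_le_sum_rpow_mul_rpow (A : ℕ → ℝ≥0∞) {r t : ℝ} (ht0 : 0 < t) (ht1 : t ≤ 1)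
    (htr : t ≤ r) (N : ℕ) :
    (∑ l ∈ Finset.range N, A l) ^ r ≤ ENNReal.ofReal (max r 1) *
      ∑ i ∈ Finset.range N, A i ^ t * (∑ l ∈ Finset.range (i + 1), A l) ^ (r - t) := by
  induction N with
  | zero => simp [ENNReal.zero_rpow_of_pos (ht0.trans_le htr)]
  | succ N ih =>
    rw [Finset.sum_range_succ (fun i => A i ^ t * _), mul_add]
    refine le_trans ?_ (add_le_add ih le_rfl)
    rw [Finset.sum_range_succ]
    exact ENNReal.add_rpow_le_rpow_add_mul ht0 ht1 htr

lemma sum_le_of_add_mul_le_mul_shift {G V : ℕ → ℝ≥0∞} {c B : ℝ≥0∞} {j : ℕ} (hc : c ≠ ∞)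
    (hB : B ≠ ∞) (hV : ∀ i, V i ≤ B) (h : ∀ i, G i + c * V i ≤ c * V (i + j)) (N : ℕ) :
    ∑ i ∈ Finset.range N, G i ≤ c * (j * B) := by
  have hfin : c * ∑ i ∈ Finset.range j, V i ≠ ∞ :=
    ENNReal.mul_ne_top hc (ENNReal.sum_ne_top.2 fun i _ => ne_top_of_le_ne_top hB (hV i))
  have hfinN : c * ∑ i ∈ Finset.range N, V i ≠ ∞ :=
    ENNReal.mul_ne_top hc (ENNReal.sum_ne_top.2 fun i _ => ne_top_of_le_ne_top hB (hV i))
  have h1 : ∑ i ∈ Finset.range N, G i + c * ∑ i ∈ Finset.range N, V i ≤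
      c * (j * B) + c * ∑ i ∈ Finset.range N, V i := by
    calc ∑ i ∈ Finset.range N, G i + c * ∑ i ∈ Finset.range N, V i
        = ∑ i ∈ Finset.range N, (G i + c * V i) := by
          rw [Finset.sum_add_distrib, Finset.mul_sum]
      _ ≤ ∑ i ∈ Finset.range N, c * V (j + i) :=
          Finset.sum_le_sum fun i _ => by rw [add_comm j]; exact h i
      _ = c * ∑ i ∈ Finset.range N, V (j + i) := by rw [Finset.mul_sum]
      _ ≤ c * ∑ i ∈ Finset.range (j + N), V i := by
          rw [Finset.sum_range_add]
          gcongr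
          exact le_add_self
      _ = c * ∑ i ∈ Finset.range j, V (N + i) + c * ∑ i ∈ Finset.range N, V i := by
          rw [add_comm j, Finset.sum_range_add, mul_add, add_comm]
      _ ≤ c * (j * B) + c * ∑ i ∈ Finset.range N, V i := by
          gcongr
          refine (Finset.sum_le_sum fun i _ => hV (N + i)).trans (le_of_eq ?_)
          simp
  exact (ENNReal.add_le_add_iff_right hfinN).1 h1

/-- Either a partial sum has at least doubled over the last `j` steps, which contributes
lacunarily, or it may be replaced by the partial sum `j` steps before. -/
lemma exists_sum_rpow_mul_rpow_le {r t : ℝ} (ht0 : 0 < t) (htr : t ≤ r) {j : ℕ} (hj : 0 < j) :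
    ∃ C : ℝ≥0∞, C ≠ ∞ ∧ ∀ (A : ℕ → ℝ≥0∞) (M : ℝ≥0∞), (∀ i, A i ≤ M) → ∀ N : ℕ,
      ∑ i ∈ Finset.range N, A i ^ t * (∑ l ∈ Finset.range (i + 1), A l) ^ (r - t) ≤
        C * M ^ r + 2 ^ (r - t) *
          ∑ i ∈ Finset.range N, A (i + j) ^ t * (∑ l ∈ Finset.range (i + 1), A l) ^ (r - t) := by
  have hr : 0 < r := by linarith
  have hrt : 0 ≤ r - t := by linarith
  set u : ℝ≥0∞ := (2 ^ r)⁻¹ with hu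
  have hu1 : u < 1 := by
    rw [hu, ENNReal.inv_lt_one]
    exact ENNReal.one_lt_rpow (by norm_num) hr
  set c : ℝ≥0∞ := (1 - u)⁻¹ with hc
  have h1u0 : 1 - u ≠ 0 := (tsub_pos_of_lt hu1).ne'
  have hct : c ≠ ∞ := ENNReal.inv_ne_top.2 h1u0
  have hcu : 1 + c * u = c := by
    conv_rhs => rw [← mul_one c, ← tsub_add_cancel_of_le hu1.le, mul_add, hc,
      ENNReal.inv_mul_cancel h1u0 (ENNReal.sub_ne_top (by simp))]
  refine ⟨j * (j : ℝ≥0∞) ^ r + c * (j * (2 * j) ^ r), ?_, ?_⟩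
  · refine ENNReal.add_ne_top.2 ⟨ENNReal.mul_ne_top (by simp)
      (ENNReal.rpow_ne_top_of_nonneg hr.le (by simp)), ENNReal.mul_ne_top hct
      (ENNReal.mul_ne_top (by simp) (ENNReal.rpow_ne_top_of_nonneg hr.le ?_))⟩
    exact ENNReal.mul_ne_top (by simp) (by simp)
  intro A M hA N
  by_cases hM : M = ∞
  · rw [hM, ENNReal.top_rpow_of_pos hr, ENNReal.mul_top, top_add]
    · exact le_top
    · simp [ENNReal.rpow_eq_zero_iff, hj.ne']
  set T : ℕ → ℝ≥0∞ := fun i => ∑ l ∈ Finset.range (i + 1), A l with hT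
  have hTmono : Monotone T := fun i k hik =>
    Finset.sum_le_sum_of_subset (Finset.range_mono (by omega))
  have hAT : ∀ i, A i ≤ T i := fun i =>
    Finset.single_le_sum (f := A) (fun _ _ => bot_le) (Finset.self_mem_range_succ i)
  have hTle : ∀ i, T i ≤ (i + 1 : ℕ) * M := fun i =>
    (Finset.sum_le_sum fun l _ => hA l).trans (le_of_eq (by simp))
  have hTfin : ∀ i, T i ≠ ∞ := fun i =>
    ne_top_of_le_ne_top (ENNReal.mul_ne_top (by simp) hM) (hTle i)
  have hTj : ∀ i, T (i + j) ≤ T i + j * M := by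
    intro i
    simp only [hT]
    rw [show i + j + 1 = i + 1 + j by ring, Finset.sum_range_add]
    gcongr
    exact (Finset.sum_le_sum fun l _ => hA _).trans (le_of_eq (by simp))
  set B : ℝ≥0∞ := (2 * j * M) ^ r with hB
  have hBt : B ≠ ∞ := ENNReal.rpow_ne_top_of_nonneg hr.le
    (ENNReal.mul_ne_top (ENNReal.mul_ne_top (by simp) (by simp)) hM)
  set V : ℕ → ℝ≥0∞ := fun i => min (T i ^ r) B with hV
  set G : ℕ → ℝ≥0∞ := fun i => if T (i + j) ≤ 2 * T i then 0 else T (i + j) ^ r with hG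
  have hGsum : ∑ i ∈ Finset.range N, G i ≤ c * (j * B) := by
    refine sum_le_of_add_mul_le_mul_shift (V := V) hct hBt (fun i => min_le_right _ _) (fun i => ?_) N
    · simp only [hG]
      split_ifs with h
      · rw [zero_add]
        have : V i ≤ V (i + j) :=
          min_le_min (ENNReal.rpow_le_rpow (hTmono (by omega)) hr.le) le_rfl
        gcongr
      · push Not at h
        have h1 : T (i + j) ≤ 2 * j * M := by
          have h2 : T (i + j) + T (i + j) ≤ T (i + j) + 2 * j * M := by
            calc T (i + j) + T (i + j) ≤ (T i + j * M) + (T i + j * M) :=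
                  add_le_add (hTj i) (hTj i)
              _ = 2 * T i + 2 * j * M := by ring
              _ ≤ _ := by gcongr
          exact (ENNReal.add_le_add_iff_left (hTfin _)).1 h2
        have h3 : V (i + j) = T (i + j) ^ r := min_eq_left (ENNReal.rpow_le_rpow h1 hr.le)
        have h4 : V i ≤ u * T (i + j) ^ r := by
          refine (min_le_left _ _).trans ?_
          rw [hu, mul_comm, ← div_eq_mul_inv, ENNReal.le_div_iff_mul_le (by simp) (by simp [hr.le]),
            ← ENNReal.mul_rpow_of_nonneg _ _ hr.le, mul_comm]
          exact ENNReal.rpow_le_rpow h.le hr.le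
        calc T (i + j) ^ r + c * V i ≤ T (i + j) ^ r + c * (u * T (i + j) ^ r) := by gcongr
          _ = (1 + c * u) * T (i + j) ^ r := by ring
          _ = c * V (i + j) := by rw [hcu, h3]
  have hX : ∀ i, A i ^ t * T i ^ (r - t) ≤ T i ^ r := by
    intro i
    calc A i ^ t * T i ^ (r - t) ≤ T i ^ t * T i ^ (r - t) := by
          gcongr
          exact hAT i
      _ = T i ^ r := by
          rw [← ENNReal.rpow_add_of_nonneg _ _ ht0.le hrt]
          congr 1; ring
  have hstep : ∀ i, A (i + j) ^ t * T (i + j) ^ (r - t) ≤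
      G i + 2 ^ (r - t) * (A (i + j) ^ t * T i ^ (r - t)) := by
    intro i
    simp only [hG]
    split_ifs with h
    · rw [zero_add]
      calc A (i + j) ^ t * T (i + j) ^ (r - t) ≤ A (i + j) ^ t * (2 * T i) ^ (r - t) := by gcongr
        _ = _ := by rw [ENNReal.mul_rpow_of_nonneg _ _ hrt]; ring
    · exact (hX _).trans le_self_add
  calc ∑ i ∈ Finset.range N, A i ^ t * T i ^ (r - t)
      ≤ ∑ i ∈ Finset.range (j + N), A i ^ t * T i ^ (r - t) :=
        Finset.sum_le_sum_of_subset (Finset.range_mono (by omega))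
    _ = ∑ i ∈ Finset.range j, A i ^ t * T i ^ (r - t) +
        ∑ i ∈ Finset.range N, A (i + j) ^ t * T (i + j) ^ (r - t) := by
        rw [Finset.sum_range_add]
        simp only [add_comm j]
    _ ≤ ∑ i ∈ Finset.range j, (j * M) ^ r +
        ∑ i ∈ Finset.range N, (G i + 2 ^ (r - t) * (A (i + j) ^ t * T i ^ (r - t))) := by
        refine add_le_add (Finset.sum_le_sum fun i hi => (hX i).trans ?_)
          (Finset.sum_le_sum fun i _ => hstep i)
        refine ENNReal.rpow_le_rpow ((hTle i).trans ?_) hr.le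
        gcongr
        exact Finset.mem_range.1 hi
    _ ≤ j * (j * M) ^ r + (c * (j * B) +
        2 ^ (r - t) * ∑ i ∈ Finset.range N, A (i + j) ^ t * T i ^ (r - t)) := by
        rw [Finset.sum_add_distrib, ← Finset.mul_sum]
        simp only [Finset.sum_const, Finset.card_range, nsmul_eq_mul]
        gcongr
    _ = _ := by
        rw [hB, ENNReal.mul_rpow_of_nonneg _ _ hr.le, ENNReal.mul_rpow_of_nonneg _ _ hr.le]
        ring

end Sequences

section Averaging

variable {n : ℕ}

/-- The normalized quotient `(f(x,ρ) / ρ^d)^{1/s}`. -/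
noncomputable def scaleQuot (f : EuclideanSpace ℝ (Fin n) → ℝ → ℝ≥0∞) (d s : ℝ)
    (x : EuclideanSpace ℝ (Fin n)) (ρ : ℝ) : ℝ≥0∞ :=
  (f x ρ / ENNReal.ofReal (ρ ^ d)) ^ (1 / s)

/-- The dyadic sequence of normalized quotients at the scales `L, L/2, L/4, …`, where the scales
above `L` are collected in the initial term. -/
noncomputable def dyadicQuot (f : EuclideanSpace ℝ (Fin n) → ℝ → ℝ≥0∞) (d s L : ℝ)
    (x : EuclideanSpace ℝ (Fin n)) : ℕ → ℝ≥0∞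
  | 0 => ⨆ k : ℕ, scaleQuot f d s x (L * 2 ^ k)
  | i + 1 => scaleQuot f d s x (L / 2 ^ (i + 1))

variable {f : EuclideanSpace ℝ (Fin n) → ℝ → ℝ≥0∞} {d s L : ℝ}

lemma scaleQuot_le_dyadicQuot (x : EuclideanSpace ℝ (Fin n)) (i : ℕ) :
    scaleQuot f d s x (L / 2 ^ i) ≤ dyadicQuot f d s L x i := by
  cases i with
  | zero =>
    simp only [dyadicQuot]
    exact le_iSup_of_le 0 (by simp)
  | succ i => exact le_rfl

lemma dyadicQuot_le (hL : 0 < L) {x : EuclideanSpace ℝ (Fin n)} {M : ℝ≥0∞}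
    (hM : ∀ ρ, 0 < ρ → scaleQuot f d s x ρ ≤ M) (i : ℕ) : dyadicQuot f d s L x i ≤ M := by
  cases i with
  | zero => exact iSup_le fun k => hM _ (by positivity)
  | succ i => exact hM _ (by positivity)

lemma measurable_scaleQuot (hmeas : ∀ ρ, Measurable fun x => f x ρ) (ρ : ℝ) :
    Measurable fun x => scaleQuot f d s x ρ :=
  ((hmeas ρ).div_const _).pow_const _

lemma measurable_dyadicQuot (hmeas : ∀ ρ, Measurable fun x => f x ρ) (i : ℕ) :
    Measurable fun x => dyadicQuot f d s L x i := by
  cases i with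
  | zero => exact Measurable.iSup fun k => measurable_scaleQuot hmeas _
  | succ i => exact measurable_scaleQuot hmeas _

lemma scaleQuot_le_mul (hs : 0 < s)
    (hmono : ∀ x y ρ ρ', dist x y + ρ ≤ ρ' → f x ρ ≤ f y ρ')
    {x y : EuclideanSpace ℝ (Fin n)} {ρ : ℝ} (hρ : 0 < ρ) (hxy : dist y x ≤ ρ) :
    scaleQuot f d s y ρ ≤ ENNReal.ofReal ((2 : ℝ) ^ d) ^ (1 / s) * scaleQuot f d s x (2 * ρ) := by
  have hs' : 0 ≤ 1 / s := by positivity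
  have h2 : (0 : ℝ) < 2 ^ d := by positivity
  have hρd : (0 : ℝ) < ρ ^ d := by positivity
  unfold scaleQuot
  rw [← ENNReal.mul_rpow_of_nonneg _ _ hs', Real.mul_rpow (by norm_num) hρ.le,
    ENNReal.ofReal_mul h2.le, ← mul_div_assoc, ENNReal.mul_div_mul_left _ _
      (by simpa using h2) ENNReal.ofReal_ne_top]
  gcongr
  exact hmono _ _ _ _ (by linarith)

lemma sum_dyadicQuot_le_mul (hs : 0 < s) (hL : 0 < L)
    (hmono : ∀ x y ρ ρ', dist x y + ρ ≤ ρ' → f x ρ ≤ f y ρ')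
    {x y : EuclideanSpace ℝ (Fin n)} {m : ℕ} (hxy : dist y x ≤ L / 2 ^ m) :
    ∑ l ∈ Finset.range (m + 1), dyadicQuot f d s L y l ≤
      2 * ENNReal.ofReal ((2 : ℝ) ^ d) ^ (1 / s) *
        ∑ l ∈ Finset.range (m + 1), dyadicQuot f d s L x l := by
  set κ := ENNReal.ofReal ((2 : ℝ) ^ d) ^ (1 / s)
  have hpow : ∀ i ≤ m, L / 2 ^ m ≤ L / 2 ^ i := by
    intro i hi
    gcongr
    norm_num
  have h0 : dyadicQuot f d s L y 0 ≤ κ * dyadicQuot f d s L x 0 := by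
    refine iSup_le fun k => ?_
    have hk : dist y x ≤ L * 2 ^ k := by
      calc dist y x ≤ L / 2 ^ 0 := hxy.trans (hpow 0 (by omega))
        _ = L * 1 := by simp
        _ ≤ L * 2 ^ k := by
          gcongr
          exact one_le_pow₀ (by norm_num)
    refine (scaleQuot_le_mul hs hmono (by positivity) hk).trans ?_
    gcongr
    refine le_iSup_of_le (k + 1) (le_of_eq ?_)
    ring_nf
  have h1 : ∀ i < m, dyadicQuot f d s L y (i + 1) ≤ κ * dyadicQuot f d s L x i := by
    intro i hi
    refine (scaleQuot_le_mul hs hmono (by positivity) (hxy.trans (hpow (i + 1) hi))).trans ?_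
    gcongr
    rw [show 2 * (L / 2 ^ (i + 1)) = L / 2 ^ i by field_simp; ring]
    exact scaleQuot_le_dyadicQuot x i
  rw [Finset.sum_range_succ' _ m]
  calc _ ≤ ∑ l ∈ Finset.range m, κ * dyadicQuot f d s L x l + κ * dyadicQuot f d s L x 0 :=
        add_le_add (Finset.sum_le_sum fun i hi => h1 i (Finset.mem_range.1 hi)) h0
    _ ≤ κ * ∑ l ∈ Finset.range (m + 1), dyadicQuot f d s L x l +
        κ * ∑ l ∈ Finset.range (m + 1), dyadicQuot f d s L x l := by
        rw [← Finset.mul_sum]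
        gcongr
        · omega
        · exact Finset.single_le_sum (f := dyadicQuot f d s L x) (fun _ _ => bot_le)
            (Finset.mem_range.2 (by omega))
    _ = _ := by ring

lemma lintegral_le_of_setLIntegral_ball_le {F H : EuclideanSpace ℝ (Fin n) → ℝ≥0∞}
    (hF : Measurable F) {R : ℝ} (hR : 0 < R)
    (h : ∀ z, ∫⁻ x in ball z R, F x ≤ volume (ball (0 : EuclideanSpace ℝ (Fin n)) R) * H z) :
    ∫⁻ x, F x ≤ ∫⁻ x, H x := by
  set v := volume (ball (0 : EuclideanSpace ℝ (Fin n)) R) with hv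
  have hv0 : v ≠ 0 := (measure_ball_pos _ _ hR).ne'
  have hvt : v ≠ ∞ := measure_ball_lt_top.ne
  have hm : Measurable (Function.uncurry fun x z : EuclideanSpace ℝ (Fin n) =>
      (ball z R).indicator F x) := by
    have : (Function.uncurry fun x z : EuclideanSpace ℝ (Fin n) => (ball z R).indicator F x) =
        {w : EuclideanSpace ℝ (Fin n) × EuclideanSpace ℝ (Fin n) | dist w.1 w.2 < R}.indicator
          fun w => F w.1 := by
      ext ⟨x, z⟩
      rfl
    rw [this]
    exact (hF.comp measurable_fst).indicator
      (isOpen_lt (by fun_prop) continuous_const).measurableSet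
  refine (ENNReal.mul_le_mul_iff_right hv0 hvt).1 ?_
  calc v * ∫⁻ x, F x = ∫⁻ x, v * F x := (lintegral_const_mul' _ _ hvt).symm
    _ = ∫⁻ x, ∫⁻ z, (ball z R).indicator F x := by
        congr 1 with x
        have : ∀ z, (ball z R).indicator F x = (ball x R).indicator (fun _ => F x) z := by
          intro z
          by_cases h : x ∈ ball z R
          · rw [indicator_of_mem h, indicator_of_mem (mem_ball_comm.1 h)]
          · rw [indicator_of_notMem h, indicator_of_notMem fun h' => h (mem_ball_comm.1 h')]
        simp only [this]
        rw [lintegral_indicator measurableSet_ball, setLIntegral_const, mul_comm, hv]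
        rw [Measure.addHaar_ball_center volume x R]
    _ = ∫⁻ z, ∫⁻ x, (ball z R).indicator F x := lintegral_lintegral_swap hm.aemeasurable
    _ ≤ ∫⁻ z, v * H z := by
        refine lintegral_mono fun z => ?_
        rw [lintegral_indicator measurableSet_ball]
        exact h z
    _ = v * ∫⁻ z, H z := lintegral_const_mul' _ _ hvt

lemma lintegral_rpow_le_rpow_mul_measure {X : Type*} [MeasurableSpace X] {μ : Measure X}
    {g : X → ℝ≥0∞} (hg : Measurable g) {θ : ℝ} (h0 : 0 < θ) (h1 : θ ≤ 1) :
    ∫⁻ x, g x ^ θ ∂μ ≤ (∫⁻ x, g x ∂μ) ^ θ * μ univ ^ (1 - θ) := by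
  have h := eLpNorm'_le_eLpNorm'_mul_rpow_measure_univ h0 h1 hg.aestronglyMeasurable (μ := μ)
  simp only [eLpNorm', enorm_eq_self, ENNReal.rpow_one, div_one] at h
  have h2 := ENNReal.rpow_le_rpow h h0.le
  rw [← ENNReal.rpow_mul, one_div_mul_cancel h0.ne', ENNReal.rpow_one,
    ENNReal.mul_rpow_of_nonneg _ _ h0.le, ← ENNReal.rpow_mul (μ univ)] at h2
  convert h2 using 3
  field_simp

/-- Averages of small-scale quotients over a ball decay geometrically in the number of scales. -/
lemma setLIntegral_dyadicQuot_le {t : ℝ} (hs : 0 < s) (hL : 0 < L) (ht0 : 0 < t) (hts : t ≤ s)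
    (hmeas : ∀ ρ, Measurable fun x => f x ρ) {C₁ : ℝ≥0∞}
    (havg : ∀ z ρ R, 0 < ρ → ρ ≤ R →
      ∫⁻ x in ball z R, f x ρ ≤ C₁ * ENNReal.ofReal (ρ ^ n) * f z (2 * R))
    (m : ℕ) {j : ℕ} (hj : 0 < j) (z : EuclideanSpace ℝ (Fin n)) :
    ∫⁻ x in ball z (L / 2 ^ (m + 1)), dyadicQuot f d s L x (m + j) ^ t ≤
      volume (ball (0 : EuclideanSpace ℝ (Fin n)) (L / 2 ^ (m + 1))) *
        ((C₁ * ENNReal.ofReal (2 ^ n) / volume (ball (0 : EuclideanSpace ℝ (Fin n)) 1)) ^ (t / s) *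
          ENNReal.ofReal ((2 : ℝ) ^ (-((n - d) * (t / s)))) ^ j * dyadicQuot f d s L z m ^ t) := by
  obtain ⟨j, rfl⟩ : ∃ k, j = k + 1 := ⟨j - 1, by omega⟩
  set R := L / 2 ^ (m + 1) with hR
  set ρ := L / 2 ^ (m + (j + 1)) with hρ
  have hR0 : 0 < R := by positivity
  have hρ0 : 0 < ρ := by positivity
  have hρR : ρ ≤ R := by
    rw [hρ, hR]
    gcongr
    · norm_num
    · omega
  have hρ2R : ρ = 2 * R * 2⁻¹ ^ (j + 1) := by
    rw [hρ, hR, inv_pow, ← add_assoc, pow_add, pow_add]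
    field_simp
    ring
  set θ := t / s with hθ
  have hθ0 : 0 < θ := by positivity
  have hθ1 : θ ≤ 1 := by rw [hθ, div_le_one hs]; exact hts
  set ω := volume (ball (0 : EuclideanSpace ℝ (Fin n)) 1) with hω
  have hω0 : ω ≠ 0 := (measure_ball_pos _ _ one_pos).ne'
  have hωt : ω ≠ ∞ := measure_ball_lt_top.ne
  set v := volume (ball (0 : EuclideanSpace ℝ (Fin n)) R) with hv
  have hv0 : v ≠ 0 := (measure_ball_pos _ _ hR0).ne'
  have hvt : v ≠ ∞ := measure_ball_lt_top.ne
  have hvz : volume (ball z R) = v := Measure.addHaar_ball_center volume z R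
  have hvR : v = ENNReal.ofReal (R ^ n) * ω := by
    rw [hv, Measure.addHaar_ball_of_pos _ _ hR0, finrank_euclideanSpace_fin]
  set a := f z (2 * R) / ENNReal.ofReal ((2 * R) ^ d) with ha
  have hρd : ENNReal.ofReal (ρ ^ d) ≠ 0 := by simpa using Real.rpow_pos_of_pos hρ0 d
  have hRd : ENNReal.ofReal ((2 * R) ^ d) ≠ 0 := by
    simpa using Real.rpow_pos_of_pos (by positivity : 0 < 2 * R) d
  have hfa : f z (2 * R) = a * ENNReal.ofReal ((2 * R) ^ d) := by
    rw [ha, ENNReal.div_mul_cancel hRd ENNReal.ofReal_ne_top]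
  have hint : ∫⁻ x in ball z R, f x ρ / ENNReal.ofReal (ρ ^ d) ≤
      C₁ * ENNReal.ofReal (2 ^ n) / ω * ENNReal.ofReal ((2 : ℝ) ^ (-((n - d) * (j + 1)))) *
        v * a := by
    simp only [div_eq_mul_inv (f _ _)]
    rw [lintegral_mul_const' _ _ (ENNReal.inv_ne_top.2 hρd)]
    calc (∫⁻ x in ball z R, f x ρ) * (ENNReal.ofReal (ρ ^ d))⁻¹
        ≤ C₁ * ENNReal.ofReal (ρ ^ n) * f z (2 * R) * (ENNReal.ofReal (ρ ^ d))⁻¹ := by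
          gcongr
          exact havg z ρ R hρ0 hρR
      _ = C₁ * ENNReal.ofReal (ρ ^ n * (2 * R) ^ d * (ρ ^ d)⁻¹) * a := by
          rw [hfa, ← ENNReal.ofReal_inv_of_pos (by positivity), ENNReal.ofReal_mul (by positivity),
            ENNReal.ofReal_mul (by positivity)]
          ring
      _ = C₁ * ENNReal.ofReal (2 ^ n * 2 ^ (-((n - d) * (j + 1))) * R ^ n) * a := by
          congr 3
          have hw : (0 : ℝ) < 2⁻¹ ^ (j + 1) := by positivity
          have hw2 : ((2 : ℝ)⁻¹ ^ (j + 1)) ^ n * ((2⁻¹ ^ (j + 1)) ^ d)⁻¹ =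
              2 ^ (-((n - d) * (j + 1))) := by
            rw [← Real.rpow_natCast _ n, ← Real.rpow_neg hw.le, ← Real.rpow_add hw,
              ← Real.rpow_natCast, ← Real.rpow_mul (by norm_num), Real.inv_rpow (by norm_num),
              ← Real.rpow_neg (by norm_num)]
            congr 1
            push_cast
            ring
          have hRd' : (0 : ℝ) < (2 * R) ^ d := by positivity
          rw [← hw2, hρ2R, mul_pow, mul_pow, Real.mul_rpow (by positivity) hw.le, mul_inv]
          field_simp
      _ = C₁ * ENNReal.ofReal (2 ^ n) / ω * ENNReal.ofReal ((2 : ℝ) ^ (-((n - d) * (j + 1)))) *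
        v * a := by
          rw [hvR, ENNReal.ofReal_mul (by positivity), ENNReal.ofReal_mul (by positivity),
            div_eq_mul_inv]
          calc _ = C₁ * ENNReal.ofReal (2 ^ n) * ENNReal.ofReal ((2 : ℝ) ^ (-((n - d) * (j + 1))))
                * ENNReal.ofReal (R ^ n) * a * 1 := by ring
            _ = C₁ * ENNReal.ofReal (2 ^ n) * ENNReal.ofReal ((2 : ℝ) ^ (-((n - d) * (j + 1))))
                * ENNReal.ofReal (R ^ n) * a * (ω⁻¹ * ω) := by
                rw [ENNReal.inv_mul_cancel hω0 hωt]
            _ = _ := by ring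
  have haz : a ^ θ ≤ dyadicQuot f d s L z m ^ t := by
    have h1 : scaleQuot f d s z (2 * R) ≤ dyadicQuot f d s L z m := by
      rw [hR, show 2 * (L / 2 ^ (m + 1)) = L / 2 ^ m by field_simp; ring]
      exact scaleQuot_le_dyadicQuot z m
    refine le_trans (le_of_eq ?_) (ENNReal.rpow_le_rpow h1 ht0.le)
    rw [scaleQuot, ← ENNReal.rpow_mul, one_div_mul_eq_div]
  calc ∫⁻ x in ball z R, dyadicQuot f d s L x (m + (j + 1)) ^ t
      = ∫⁻ x in ball z R, (f x ρ / ENNReal.ofReal (ρ ^ d)) ^ θ := by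
        congr 1 with x
        change scaleQuot f d s x _ ^ t = _
        rw [scaleQuot, ← ENNReal.rpow_mul, one_div_mul_eq_div]
        rfl
    _ ≤ (∫⁻ x in ball z R, f x ρ / ENNReal.ofReal (ρ ^ d)) ^ θ * v ^ (1 - θ) := by
        refine (lintegral_rpow_le_rpow_mul_measure ((hmeas ρ).div_const _) hθ0 hθ1).trans ?_
        rw [Measure.restrict_apply_univ, hvz]
    _ ≤ (C₁ * ENNReal.ofReal (2 ^ n) / ω * ENNReal.ofReal ((2 : ℝ) ^ (-((n - d) * (j + 1)))) *
        v * a) ^ θ * v ^ (1 - θ) := by gcongr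
    _ = v * ((C₁ * ENNReal.ofReal (2 ^ n) / ω) ^ θ *
          ENNReal.ofReal ((2 : ℝ) ^ (-((n - d) * θ))) ^ (j + 1) * a ^ θ) := by
        rw [ENNReal.mul_rpow_of_nonneg _ _ hθ0.le, ENNReal.mul_rpow_of_nonneg _ _ hθ0.le,
          ENNReal.mul_rpow_of_nonneg _ _ hθ0.le]
        have h1 : v ^ θ * v ^ (1 - θ) = v := by
          rw [← ENNReal.rpow_add _ _ hv0 hvt, add_sub_cancel, ENNReal.rpow_one]
        have h2 : ENNReal.ofReal ((2 : ℝ) ^ (-((n - d) * (j + 1)))) ^ θ =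
            ENNReal.ofReal ((2 : ℝ) ^ (-((n - d) * θ))) ^ (j + 1) := by
          rw [ENNReal.ofReal_rpow_of_pos (by positivity), ← ENNReal.ofReal_pow (by positivity),
            ← Real.rpow_mul (by positivity), ← Real.rpow_natCast, ← Real.rpow_mul (by positivity)]
          congr 2
          push_cast
          ring
        rw [h2]
        conv_rhs => rw [← h1]
        ring
    _ ≤ _ := by gcongr

end Averaging

section Summation

variable {n : ℕ} {f : EuclideanSpace ℝ (Fin n) → ℝ → ℝ≥0∞} {d s L : ℝ}

lemma measurable_dyadicQuot_rpow_mul (hmeas : ∀ ρ, Measurable fun x => f x ρ) (i m : ℕ) (t u : ℝ) :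
    Measurable fun x => dyadicQuot f d s L x i ^ t *
      (∑ l ∈ Finset.range m, dyadicQuot f d s L x l) ^ u :=
  ((measurable_dyadicQuot hmeas i).pow_const _).mul
    ((Finset.measurable_fun_sum _ fun l _ => measurable_dyadicQuot hmeas l).pow_const _)

lemma lintegral_dyadicQuot_rpow_mul_le {t r : ℝ} (hs : 0 < s) (hL : 0 < L) (ht0 : 0 < t)
    (hts : t ≤ s) (htr : t ≤ r) (hmono : ∀ x y ρ ρ', dist x y + ρ ≤ ρ' → f x ρ ≤ f y ρ')
    (hmeas : ∀ ρ, Measurable fun x => f x ρ) {C₁ : ℝ≥0∞}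
    (havg : ∀ z ρ R, 0 < ρ → ρ ≤ R →
      ∫⁻ x in ball z R, f x ρ ≤ C₁ * ENNReal.ofReal (ρ ^ n) * f z (2 * R))
    (m : ℕ) {j : ℕ} (hj : 0 < j) :
    ∫⁻ x, dyadicQuot f d s L x (m + j) ^ t *
        (∑ l ∈ Finset.range (m + 1), dyadicQuot f d s L x l) ^ (r - t) ≤
      (2 * ENNReal.ofReal ((2 : ℝ) ^ d) ^ (1 / s)) ^ (r - t) *
        (C₁ * ENNReal.ofReal (2 ^ n) / volume (ball (0 : EuclideanSpace ℝ (Fin n)) 1)) ^ (t / s) *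
        ENNReal.ofReal ((2 : ℝ) ^ (-((n - d) * (t / s)))) ^ j *
        ∫⁻ x, dyadicQuot f d s L x m ^ t *
          (∑ l ∈ Finset.range (m + 1), dyadicQuot f d s L x l) ^ (r - t) := by
  have hrt : 0 ≤ r - t := sub_nonneg.2 htr
  rw [← lintegral_const_mul _ (measurable_dyadicQuot_rpow_mul hmeas _ _ _ _)]
  refine lintegral_le_of_setLIntegral_ball_le (measurable_dyadicQuot_rpow_mul hmeas _ _ _ _)
    (R := L / 2 ^ (m + 1)) (by positivity) fun z => ?_
  set T : EuclideanSpace ℝ (Fin n) → ℝ≥0∞ :=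
    fun x => ∑ l ∈ Finset.range (m + 1), dyadicQuot f d s L x l
  set κ := ENNReal.ofReal ((2 : ℝ) ^ d) ^ (1 / s)
  have hT : ∀ x ∈ ball z (L / 2 ^ (m + 1)), T x ≤ 2 * κ * T z := by
    intro x hx
    refine sum_dyadicQuot_le_mul hs hL hmono ((mem_ball.1 hx).le.trans ?_)
    gcongr
    · norm_num
    · omega
  calc ∫⁻ x in ball z (L / 2 ^ (m + 1)), dyadicQuot f d s L x (m + j) ^ t * T x ^ (r - t)
      ≤ ∫⁻ x in ball z (L / 2 ^ (m + 1)), dyadicQuot f d s L x (m + j) ^ t *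
          (2 * κ * T z) ^ (r - t) := by
        refine setLIntegral_mono' measurableSet_ball fun x hx => ?_
        gcongr
        exact hT x hx
    _ = (∫⁻ x in ball z (L / 2 ^ (m + 1)), dyadicQuot f d s L x (m + j) ^ t) *
          (2 * κ * T z) ^ (r - t) :=
        lintegral_mul_const _ ((measurable_dyadicQuot hmeas _).pow_const _)
    _ ≤ _ := mul_le_mul_left (setLIntegral_dyadicQuot_le hs hL ht0 hts hmeas havg m hj z) _
    _ = _ := by
        rw [ENNReal.mul_rpow_of_nonneg _ _ hrt]
        ring

/-- The constant does not depend on the number of scales or on the largest one. -/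
lemma exists_lintegral_rpow_sum_dyadicQuot_le {r : ℝ} (hs : 0 < s) (hr : 0 < r) (hd : d < n)
    {C₁ : ℝ≥0∞} (hC₁ : C₁ ≠ ∞) :
    ∃ C : ℝ≥0∞, C ≠ ∞ ∧ ∀ f : EuclideanSpace ℝ (Fin n) → ℝ → ℝ≥0∞,
      (∀ x y ρ ρ', dist x y + ρ ≤ ρ' → f x ρ ≤ f y ρ') → (∀ ρ, Measurable fun x => f x ρ) →
      (∀ z ρ R, 0 < ρ → ρ ≤ R →
        ∫⁻ x in ball z R, f x ρ ≤ C₁ * ENNReal.ofReal (ρ ^ n) * f z (2 * R)) →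
      ∀ M : EuclideanSpace ℝ (Fin n) → ℝ≥0∞, (∀ x ρ, 0 < ρ → scaleQuot f d s x ρ ≤ M x) →
      ∀ L, 0 < L → ∀ N : ℕ,
        ∫⁻ x, (∑ l ∈ Finset.range N, dyadicQuot f d s L x l) ^ r ≤ C * ∫⁻ x, M x ^ r := by
  obtain ⟨t, ht0, ht1, hts, htr⟩ : ∃ t : ℝ, 0 < t ∧ t ≤ 1 ∧ t ≤ s ∧ t ≤ r :=
    ⟨min 1 (min s r), by positivity, min_le_left _ _, (min_le_right _ _).trans (min_le_left _ _),
      (min_le_right _ _).trans (min_le_right _ _)⟩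
  have hrt : 0 ≤ r - t := sub_nonneg.2 htr
  set κ : ℝ≥0∞ := (2 * ENNReal.ofReal ((2 : ℝ) ^ d) ^ (1 / s)) ^ (r - t) *
    (C₁ * ENNReal.ofReal (2 ^ n) / volume (ball (0 : EuclideanSpace ℝ (Fin n)) 1)) ^ (t / s)
    with hκ
  have hκt : κ ≠ ∞ := by
    refine ENNReal.mul_ne_top (ENNReal.rpow_ne_top_of_nonneg hrt (ENNReal.mul_ne_top (by simp)
      (ENNReal.rpow_ne_top_of_nonneg (by positivity) ENNReal.ofReal_ne_top)))
      (ENNReal.rpow_ne_top_of_nonneg (by positivity) (ENNReal.div_ne_top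
        (ENNReal.mul_ne_top hC₁ ENNReal.ofReal_ne_top) (measure_ball_pos _ _ one_pos).ne'))
  set δ : ℝ≥0∞ := ENNReal.ofReal ((2 : ℝ) ^ (-((n - d) * (t / s)))) with hδ
  have hδ1 : δ < 1 := by
    rw [hδ, ENNReal.ofReal_lt_one]
    refine Real.rpow_lt_one_of_one_lt_of_neg (by norm_num) ?_
    have : 0 < (n : ℝ) - d := by linarith
    simp only [Left.neg_neg_iff]
    positivity
  obtain ⟨j, hj, hjle⟩ : ∃ j : ℕ, 0 < j ∧ 2 ^ (r - t) * (κ * δ ^ j) ≤ 2⁻¹ := by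
    have h1 : Filter.Tendsto (fun j : ℕ => 2 ^ (r - t) * (κ * δ ^ j)) Filter.atTop (nhds 0) := by
      have h2 := ENNReal.Tendsto.const_mul (ENNReal.Tendsto.const_mul
        (ENNReal.tendsto_pow_atTop_nhds_zero_of_lt_one hδ1) (Or.inr hκt))
        (Or.inr (ENNReal.rpow_ne_top_of_nonneg hrt (by simp : (2 : ℝ≥0∞) ≠ ∞)))
      simpa using h2
    have h2 := (h1.eventually_le_const (u := 2⁻¹) (by simp)).and (Filter.eventually_gt_atTop 0)
    obtain ⟨j, hj1, hj2⟩ := h2.exists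
    exact ⟨j, hj2, hj1⟩
  obtain ⟨C₀, hC₀, hsum⟩ := exists_sum_rpow_mul_rpow_le ht0 htr hj
  have hC : ENNReal.ofReal (max r 1) * (2 * (C₀ + 1)) ≠ 0 := by
    simp
  refine ⟨ENNReal.ofReal (max r 1) * (2 * (C₀ + 1)), ENNReal.mul_ne_top ENNReal.ofReal_ne_top
    (ENNReal.mul_ne_top (by simp) (by simp [hC₀])), ?_⟩
  intro f hmono hmeas havg M hM L hL N
  by_cases hI : ∫⁻ x, M x ^ r = ∞
  · rw [hI, ENNReal.mul_top hC]
    exact le_top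
  set A := dyadicQuot f d s L with hA
  have hAM : ∀ x i, A x i ≤ M x := fun x i => dyadicQuot_le hL (hM x) i
  set D : ℕ → ℕ → ℝ≥0∞ := fun k i => ∫⁻ x, A x (i + k) ^ t *
    (∑ l ∈ Finset.range (i + 1), A x l) ^ (r - t) with hD
  have hDm : ∀ k i, Measurable fun x => A x (i + k) ^ t *
      (∑ l ∈ Finset.range (i + 1), A x l) ^ (r - t) :=
    fun k i => measurable_dyadicQuot_rpow_mul hmeas _ _ _ _
  have hDfin : ∀ i, D 0 i ≠ ∞ := by
    intro i
    refine ne_top_of_le_ne_top (ENNReal.mul_ne_top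
      (ENNReal.rpow_ne_top_of_nonneg hrt (ENNReal.natCast_ne_top (i + 1))) hI)
      (b := ((i + 1 : ℕ) : ℝ≥0∞) ^ (r - t) * ∫⁻ x, M x ^ r) ?_
    rw [← lintegral_const_mul' _ _
      (ENNReal.rpow_ne_top_of_nonneg hrt (ENNReal.natCast_ne_top (i + 1)))]
    refine lintegral_mono fun x => ?_
    calc A x (i + 0) ^ t * (∑ l ∈ Finset.range (i + 1), A x l) ^ (r - t)
        ≤ M x ^ t * (((i + 1 : ℕ) : ℝ≥0∞) * M x) ^ (r - t) := by
          gcongr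
          · exact hAM x _
          · exact (Finset.sum_le_sum fun l _ => hAM x l).trans (le_of_eq (by simp))
      _ = ((i + 1 : ℕ) : ℝ≥0∞) ^ (r - t) * M x ^ r := by
          rw [ENNReal.mul_rpow_of_nonneg _ _ hrt, mul_left_comm,
            ← ENNReal.rpow_add_of_nonneg _ _ ht0.le hrt, add_sub_cancel]
  have hDj : ∀ i, 2 ^ (r - t) * D j i ≤ 2⁻¹ * D 0 i := by
    intro i
    calc 2 ^ (r - t) * D j i ≤ 2 ^ (r - t) * (κ * δ ^ j * D 0 i) := by
          gcongr
          exact lintegral_dyadicQuot_rpow_mul_le hs hL ht0 hts htr hmono hmeas havg i hj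
      _ = 2 ^ (r - t) * (κ * δ ^ j) * D 0 i := by ring
      _ ≤ _ := by gcongr
  have hsumfin : 2⁻¹ * ∑ i ∈ Finset.range N, D 0 i ≠ ∞ :=
    ENNReal.mul_ne_top (by simp) (ENNReal.sum_ne_top.2 fun i _ => hDfin i)
  have hint : ∑ i ∈ Finset.range N, D 0 i ≤
      C₀ * (∫⁻ x, M x ^ r) + 2⁻¹ * ∑ i ∈ Finset.range N, D 0 i := by
    calc ∑ i ∈ Finset.range N, D 0 i
        = ∫⁻ x, ∑ i ∈ Finset.range N, A x i ^ t *
            (∑ l ∈ Finset.range (i + 1), A x l) ^ (r - t) :=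
          (lintegral_finsetSum _ fun i _ => hDm 0 i).symm
      _ ≤ ∫⁻ x, C₀ * M x ^ r + 2 ^ (r - t) * ∑ i ∈ Finset.range N, A x (i + j) ^ t *
            (∑ l ∈ Finset.range (i + 1), A x l) ^ (r - t) :=
          lintegral_mono fun x => hsum (A x) (M x) (hAM x) N
      _ = C₀ * (∫⁻ x, M x ^ r) + 2 ^ (r - t) * ∑ i ∈ Finset.range N, D j i := by
          rw [lintegral_add_right _
            ((Finset.measurable_fun_sum _ fun i _ => hDm j i).const_mul _),
            lintegral_const_mul' _ _ hC₀,
            lintegral_const_mul _ (Finset.measurable_fun_sum _ fun i _ => hDm j i),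
            lintegral_finsetSum _ fun i _ => hDm j i]
      _ ≤ _ := by
          refine add_le_add le_rfl ?_
          rw [Finset.mul_sum, Finset.mul_sum]
          exact Finset.sum_le_sum fun i _ => hDj i
  have hhalf : ∑ i ∈ Finset.range N, D 0 i ≤ 2 * (C₀ * ∫⁻ x, M x ^ r) := by
    have h1 : 2⁻¹ * ∑ i ∈ Finset.range N, D 0 i ≤ C₀ * ∫⁻ x, M x ^ r := by
      refine (ENNReal.add_le_add_iff_right hsumfin).1 (le_trans (le_of_eq ?_) hint)
      rw [← add_mul, ENNReal.inv_two_add_inv_two, one_mul]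
    calc ∑ i ∈ Finset.range N, D 0 i = 2 * (2⁻¹ * ∑ i ∈ Finset.range N, D 0 i) := by
          rw [← mul_assoc, ENNReal.mul_inv_cancel (by simp) (by simp), one_mul]
      _ ≤ _ := by gcongr
  calc ∫⁻ x, (∑ l ∈ Finset.range N, A x l) ^ r
      ≤ ∫⁻ x, ENNReal.ofReal (max r 1) * ∑ i ∈ Finset.range N, A x i ^ t *
          (∑ l ∈ Finset.range (i + 1), A x l) ^ (r - t) :=
        lintegral_mono fun x => rpow_sum_le_sum_rpow_mul_rpow (A x) ht0 ht1 htr N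
    _ = ENNReal.ofReal (max r 1) * ∑ i ∈ Finset.range N, D 0 i := by
        rw [lintegral_const_mul' _ _ ENNReal.ofReal_ne_top]
        congr 1
        exact lintegral_finsetSum _ fun i _ => hDm 0 i
    _ ≤ ENNReal.ofReal (max r 1) * (2 * (C₀ * ∫⁻ x, M x ^ r)) := by gcongr
    _ ≤ ENNReal.ofReal (max r 1) * (2 * ((C₀ + 1) * ∫⁻ x, M x ^ r)) := by
        gcongr
        exact le_self_add
    _ = _ := by ring

end Summation

section Potential

variable {n : ℕ} {f : EuclideanSpace ℝ (Fin n) → ℝ → ℝ≥0∞} {d s : ℝ}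

lemma scaleQuot_le_mul_scaleQuot (hs : 0 < s) (hd : 0 ≤ d) {x : EuclideanSpace ℝ (Fin n)}
    (hf : Monotone (f x)) {ρ ρ' : ℝ} (hρ : 0 < ρ) (h1 : ρ ≤ ρ') (h2 : ρ' ≤ 2 * ρ) :
    scaleQuot f d s x ρ ≤ ENNReal.ofReal ((2 : ℝ) ^ d) ^ (1 / s) * scaleQuot f d s x ρ' := by
  have hs' : 0 ≤ 1 / s := by positivity
  have h2d : (0 : ℝ) < 2 ^ d := by positivity
  unfold scaleQuot
  rw [← ENNReal.mul_rpow_of_nonneg _ _ hs']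
  refine ENNReal.rpow_le_rpow ?_ hs'
  calc f x ρ / ENNReal.ofReal (ρ ^ d)
      = ENNReal.ofReal (2 ^ d) * f x ρ / ENNReal.ofReal ((2 * ρ) ^ d) := by
        rw [Real.mul_rpow (by norm_num) hρ.le, ENNReal.ofReal_mul h2d.le,
          ENNReal.mul_div_mul_left _ _ (by simpa using h2d) ENNReal.ofReal_ne_top]
    _ ≤ ENNReal.ofReal (2 ^ d) * f x ρ' / ENNReal.ofReal (ρ' ^ d) := by
        have : 0 < ρ' := hρ.trans_le h1
        gcongr
        exact hf h1
    _ = _ := mul_div_assoc _ _ _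

lemma setLIntegral_Ioc_scaleQuot_le (hs : 0 < s) (hd : 0 ≤ d) {x : EuclideanSpace ℝ (Fin n)}
    (hf : Monotone (f x)) {a : ℝ} (ha : 0 < a) :
    ∫⁻ ρ in Ioc a (2 * a), scaleQuot f d s x ρ / ENNReal.ofReal ρ ≤
      ENNReal.ofReal ((2 : ℝ) ^ d) ^ (1 / s) * scaleQuot f d s x (2 * a) := by
  set κ := ENNReal.ofReal ((2 : ℝ) ^ d) ^ (1 / s)
  calc ∫⁻ ρ in Ioc a (2 * a), scaleQuot f d s x ρ / ENNReal.ofReal ρ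
      ≤ ∫⁻ _ in Ioc a (2 * a), κ * scaleQuot f d s x (2 * a) / ENNReal.ofReal a := by
        refine setLIntegral_mono' measurableSet_Ioc fun ρ hρ => ?_
        gcongr
        · exact scaleQuot_le_mul_scaleQuot hs hd hf (ha.trans hρ.1) hρ.2 (by linarith [hρ.1])
        · exact hρ.1.le
    _ = κ * scaleQuot f d s x (2 * a) := by
        rw [setLIntegral_const, Real.volume_Ioc, show 2 * a - a = a by ring,
          ENNReal.div_mul_cancel (by simpa using ha) ENNReal.ofReal_ne_top]

lemma scaleQuot_le_lintegral (hs : 0 < s) (hd : 0 ≤ d) {x : EuclideanSpace ℝ (Fin n)}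
    (hf : Monotone (f x)) {a : ℝ} (ha : 0 < a) :
    scaleQuot f d s x a ≤ 2 * ENNReal.ofReal ((2 : ℝ) ^ d) ^ (1 / s) *
      ∫⁻ ρ in Ioi 0, scaleQuot f d s x ρ / ENNReal.ofReal ρ := by
  set κ := ENNReal.ofReal ((2 : ℝ) ^ d) ^ (1 / s)
  have hκ : κ ≠ ∞ := ENNReal.rpow_ne_top_of_nonneg (by positivity) ENNReal.ofReal_ne_top
  have ha0 : ENNReal.ofReal a ≠ 0 := by simpa using ha
  calc scaleQuot f d s x a
      = 2 * ∫⁻ _ in Ioc a (2 * a), scaleQuot f d s x a / ENNReal.ofReal (2 * a) := by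
        rw [setLIntegral_const, Real.volume_Ioc, show 2 * a - a = a by ring,
          ENNReal.ofReal_mul (by norm_num), ENNReal.ofReal_ofNat, mul_comm 2, ENNReal.div_eq_inv_mul,
          ENNReal.mul_inv (by simp) (by simp)]
        calc _ = scaleQuot f d s x a * (2⁻¹ * 2) * ((ENNReal.ofReal a)⁻¹ * ENNReal.ofReal a) := by
              rw [ENNReal.inv_mul_cancel ha0 ENNReal.ofReal_ne_top,
                ENNReal.inv_mul_cancel (by simp) (by simp), mul_one, mul_one]
          _ = _ := by ring
    _ ≤ 2 * ∫⁻ ρ in Ioc a (2 * a), κ * (scaleQuot f d s x ρ / ENNReal.ofReal ρ) := by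
        refine mul_le_mul_right (setLIntegral_mono' measurableSet_Ioc fun ρ hρ => ?_) _
        rw [← mul_div_assoc]
        gcongr
        · exact scaleQuot_le_mul_scaleQuot hs hd hf ha hρ.1.le hρ.2
        · exact hρ.2
    _ = 2 * κ * ∫⁻ ρ in Ioc a (2 * a), scaleQuot f d s x ρ / ENNReal.ofReal ρ := by
        rw [lintegral_const_mul' _ _ hκ, mul_assoc]
    _ ≤ _ := by
        gcongr
        exact fun ρ hρ => ha.trans hρ.1

lemma lintegral_scaleQuot_le_tsum (hs : 0 < s) (hd : 0 ≤ d) {x : EuclideanSpace ℝ (Fin n)}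
    (hf : Monotone (f x)) :
    ∫⁻ ρ in Ioi 0, scaleQuot f d s x ρ / ENNReal.ofReal ρ ≤
      ENNReal.ofReal ((2 : ℝ) ^ d) ^ (1 / s) * ∑' i : ℤ, scaleQuot f d s x (2 ^ i) := by
  have hsub : Ioi (0 : ℝ) ⊆ ⋃ i : ℤ, Ioc ((2 : ℝ) ^ i) (2 * 2 ^ i) := by
    intro ρ hρ
    obtain ⟨i, hi⟩ := exists_mem_Ioc_zpow (mem_Ioi.1 hρ) (one_lt_two : (1 : ℝ) < 2)
    refine mem_iUnion.2 ⟨i, ?_⟩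
    rwa [zpow_add_one₀ (by norm_num), mul_comm] at hi
  calc ∫⁻ ρ in Ioi 0, scaleQuot f d s x ρ / ENNReal.ofReal ρ
      ≤ ∑' i : ℤ, ∫⁻ ρ in Ioc ((2 : ℝ) ^ i) (2 * 2 ^ i),
          scaleQuot f d s x ρ / ENNReal.ofReal ρ :=
        (lintegral_mono_set hsub).trans (lintegral_iUnion_le _ _)
    _ ≤ ∑' i : ℤ, ENNReal.ofReal ((2 : ℝ) ^ d) ^ (1 / s) * scaleQuot f d s x (2 ^ (i + 1)) := by
        refine ENNReal.tsum_le_tsum fun i => ?_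
        rw [zpow_add_one₀ (by norm_num), mul_comm _ (2 : ℝ)]
        exact setLIntegral_Ioc_scaleQuot_le hs hd hf (by positivity)
    _ = _ := by
        rw [ENNReal.tsum_mul_left]
        congr 1
        exact (Equiv.addRight (1 : ℤ)).tsum_eq fun i => scaleQuot f d s x (2 ^ i)

lemma sum_Icc_scaleQuot_le (x : EuclideanSpace ℝ (Fin n)) (N : ℕ) :
    ∑ i ∈ Finset.Icc (-(N : ℤ)) N, scaleQuot f d s x (2 ^ i) ≤
      ∑ l ∈ Finset.range (2 * N + 1), dyadicQuot f d s (2 ^ N) x l := by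
  calc ∑ i ∈ Finset.Icc (-(N : ℤ)) N, scaleQuot f d s x (2 ^ i)
      = ∑ l ∈ Finset.range (2 * N + 1), scaleQuot f d s x (2 ^ N / 2 ^ l) := by
        refine Finset.sum_nbij' (fun i => (N - i).toNat) (fun l => (N : ℤ) - l) ?_ ?_ ?_ ?_ ?_
        · intro i hi
          rw [Finset.mem_Icc] at hi
          rw [Finset.mem_range]
          omega
        · intro l hl
          rw [Finset.mem_range] at hl
          rw [Finset.mem_Icc]
          omega
        · intro i hi
          rw [Finset.mem_Icc] at hi
          omega
        · intro l hl
          omega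
        · intro i hi
          rw [Finset.mem_Icc] at hi
          congr 1
          rw [eq_div_iff (by positivity), ← zpow_natCast, ← zpow_natCast,
            ← zpow_add₀ (by norm_num)]
          congr 1
          omega
    _ ≤ _ := Finset.sum_le_sum fun l _ => scaleQuot_le_dyadicQuot x l

/-- If averages of `f` over balls decay like those of a superadditive set function, then the
integrated potential is controlled by the maximal one. -/
lemma exists_lintegral_potential_rpow_le {r : ℝ} (hs : 0 < s) (hr : 0 < r) (hd0 : 0 ≤ d)
    (hd : d < n) {C₁ : ℝ≥0∞} (hC₁ : C₁ ≠ ∞) :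
    ∃ C : ℝ≥0∞, C ≠ ∞ ∧ ∀ f : EuclideanSpace ℝ (Fin n) → ℝ → ℝ≥0∞,
      (∀ x y ρ ρ', dist x y + ρ ≤ ρ' → f x ρ ≤ f y ρ') → (∀ ρ, Measurable fun x => f x ρ) →
      (∀ z ρ R, 0 < ρ → ρ ≤ R →
        ∫⁻ x in ball z R, f x ρ ≤ C₁ * ENNReal.ofReal (ρ ^ n) * f z (2 * R)) →
      ∀ M : EuclideanSpace ℝ (Fin n) → ℝ≥0∞, (∀ x ρ, 0 < ρ → scaleQuot f d s x ρ ≤ M x) →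
        ∫⁻ x, (∫⁻ ρ in Ioi 0, scaleQuot f d s x ρ / ENNReal.ofReal ρ) ^ r ≤
          C * ∫⁻ x, M x ^ r := by
  obtain ⟨C, hC, h⟩ := exists_lintegral_rpow_sum_dyadicQuot_le hs hr hd hC₁
  set κ := ENNReal.ofReal ((2 : ℝ) ^ d) ^ (1 / s)
  have hκ : κ ^ r ≠ ∞ := ENNReal.rpow_ne_top_of_nonneg hr.le
    (ENNReal.rpow_ne_top_of_nonneg (by positivity) ENNReal.ofReal_ne_top)
  refine ⟨κ ^ r * C, ENNReal.mul_ne_top hκ hC, fun f hmono hmeas havg M hM => ?_⟩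
  have hf : ∀ x, Monotone (f x) := fun x ρ ρ' hρ => hmono x x ρ ρ' (by simpa using hρ)
  set S : ℕ → EuclideanSpace ℝ (Fin n) → ℝ≥0∞ :=
    fun N x => ∑ i ∈ Finset.Icc (-(N : ℤ)) N, scaleQuot f d s x (2 ^ i) with hS
  have hSmono : Monotone S := fun N N' hN x =>
    Finset.sum_le_sum_of_subset (Finset.Icc_subset_Icc (by omega) (by omega))
  have hSmeas : ∀ N, Measurable (S N) := fun N =>
    Finset.measurable_fun_sum _ fun i _ => measurable_scaleQuot hmeas _
  have hsup : ∀ x, ∑' i : ℤ, scaleQuot f d s x (2 ^ i) = ⨆ N, S N x := by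
    intro x
    refine ENNReal.tsum_eq_iSup_sum' _ fun t => ?_
    refine ⟨t.sup Int.natAbs, fun i hi => ?_⟩
    have := Finset.le_sup (f := Int.natAbs) hi
    rw [Finset.mem_Icc]
    omega
  calc ∫⁻ x, (∫⁻ ρ in Ioi 0, scaleQuot f d s x ρ / ENNReal.ofReal ρ) ^ r
      ≤ ∫⁻ x, κ ^ r * ⨆ N, S N x ^ r := by
        refine lintegral_mono fun x => ?_
        calc _ ≤ (κ * ⨆ N, S N x) ^ r := by
              rw [← hsup]
              exact ENNReal.rpow_le_rpow (lintegral_scaleQuot_le_tsum hs hd0 (hf x)) hr.le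
          _ = κ ^ r * ⨆ N, S N x ^ r := by
              rw [ENNReal.mul_rpow_of_nonneg _ _ hr.le]
              congr 1
              exact (ENNReal.orderIsoRpow r hr).map_iSup _
    _ = κ ^ r * ⨆ N, ∫⁻ x, S N x ^ r := by
        rw [lintegral_const_mul' _ _ hκ, lintegral_iSup (fun N => (hSmeas N).pow_const _)
          fun N N' hN x => ENNReal.rpow_le_rpow (hSmono hN x) hr.le]
    _ ≤ κ ^ r * (C * ∫⁻ x, M x ^ r) := by
        gcongr
        refine iSup_le fun N => le_trans (lintegral_mono fun x => ?_)
          (h f hmono hmeas havg M hM (2 ^ N) (by positivity) (2 * N + 1))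
        exact ENNReal.rpow_le_rpow (sum_Icc_scaleQuot_le x N) hr.le
    _ = _ := by ring

end Potential

/-- Enhanced Wolff inequality for the intrinsic potential: for
`n(p−1)/(n−αp) < r < ∞`,
`∫ (K_{α,p,q}σ)^r dx ≈ ∫ sup_{ρ>0} (κ(B(x,ρ))^{q(p−1)/(p−1−q)}/ρ^{n−αp})^{r/(p−1)} dx`. -/
theorem enhanced_wolff_inequality (n : ℕ) (hn : 1 ≤ n) (α p q r : ℝ)
    (hp : 1 < p) (hq0 : 0 < q) (hqp : q < p - 1)
    (hα0 : 0 < α) (hαp : α < n / p)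
    (hr : (n : ℝ) * (p - 1) / ((n : ℝ) - α * p) < r) :
    ∃ c C : ℝ, 0 < c ∧ c ≤ C ∧
      ∀ σ : Measure (EuclideanSpace ℝ (Fin n)), IsLocallyFiniteMeasure σ →
        (ENNReal.ofReal c *
            (∫⁻ x, ⨆ (ρ : ℝ) (_ : 0 < ρ),
              (embC n α p q σ (Metric.ball x ρ) ^ (q * (p - 1) / (p - 1 - q)) /
                ENNReal.ofReal (ρ ^ ((n : ℝ) - α * p))) ^ (r / (p - 1))) ≤
          ∫⁻ x, intK n α p q σ x ^ r) ∧
        ((∫⁻ x, intK n α p q σ x ^ r) ≤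
          ENNReal.ofReal C *
            (∫⁻ x, ⨆ (ρ : ℝ) (_ : 0 < ρ),
              (embC n α p q σ (Metric.ball x ρ) ^ (q * (p - 1) / (p - 1 - q)) /
                ENNReal.ofReal (ρ ^ ((n : ℝ) - α * p))) ^ (r / (p - 1)))) := by
  have hn0 : (0 : ℝ) < n := by exact_mod_cast hn
  have hp0 : 0 < p := by linarith
  have hs : 0 < p - 1 := by linarith
  have hαpn : α * p < n := (lt_div_iff₀ hp0).1 hαp
  have hd0 : 0 < (n : ℝ) - α * p := by linarith
  have hdn : (n : ℝ) - α * p < n := by linarith [mul_pos hα0 hp0]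
  have hr0 : 0 < r := lt_trans (by positivity) hr
  set d := (n : ℝ) - α * p
  set γ := q * (p - 1) / (p - 1 - q)
  have hγ : 0 ≤ γ := div_nonneg (by positivity) (by linarith)
  set C₁ : ℝ≥0∞ := ENNReal.ofReal ((2 * n) ^ n) *
    volume (closedBall (0 : EuclideanSpace ℝ (Fin n)) 1)
  have hC₁ : C₁ ≠ ∞ := ENNReal.mul_ne_top ENNReal.ofReal_ne_top measure_closedBall_lt_top.ne
  obtain ⟨C, hC, hupper⟩ := exists_lintegral_potential_rpow_le hs hr0 hd0.le hdn hC₁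
  set B : ℝ≥0∞ := (2 * ENNReal.ofReal ((2 : ℝ) ^ d) ^ (1 / (p - 1))) ^ r
  have hB : B ≠ ∞ := ENNReal.rpow_ne_top_of_nonneg hr0.le (ENNReal.mul_ne_top (by simp)
    (ENNReal.rpow_ne_top_of_nonneg (by positivity) ENNReal.ofReal_ne_top))
  have hB0 : (0 : ℝ) < B.toReal + 1 := by positivity
  refine ⟨(B.toReal + 1)⁻¹, max C.toReal 1, by positivity, ?_, fun σ _ => ?_⟩
  · exact (inv_le_one_of_one_le₀ (by linarith [B.toReal_nonneg])).trans (le_max_right _ _)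
  set f : EuclideanSpace ℝ (Fin n) → ℝ → ℝ≥0∞ := fun x ρ => embC n α p q σ (ball x ρ) ^ γ with hf
  have hmono : ∀ x y ρ ρ', dist x y + ρ ≤ ρ' → f x ρ ≤ f y ρ' := fun x y ρ ρ' h =>
    ENNReal.rpow_le_rpow (embC_mono σ hq0 (ball_subset_ball' (by linarith))) hγ
  have hmeas : ∀ ρ, Measurable fun x => f x ρ := fun ρ =>
    (lowerSemicontinuous_embC_ball hp hq0 σ ρ).measurable.pow_const _
  have havg : ∀ z ρ R, 0 < ρ → ρ ≤ R →
      ∫⁻ x in ball z R, f x ρ ≤ C₁ * ENNReal.ofReal (ρ ^ n) * f z (2 * R) := fun z ρ R hρ hρR =>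
    lintegral_ball_le_of_superadditive (fun E => embC n α p q σ E ^ γ)
      (fun E F h => ENNReal.rpow_le_rpow (embC_mono σ hq0 h) hγ)
      (fun S ρ hS => embC_rpow_sum_le hp hq0 hqp σ S _ (fun _ _ => measurableSet_ball) hS)
      hmeas z hρ hρR
  have hpow : ∀ x ρ, scaleQuot f d (p - 1) x ρ ^ r =
      (embC n α p q σ (ball x ρ) ^ γ / ENNReal.ofReal (ρ ^ d)) ^ (r / (p - 1)) := by
    intro x ρ
    rw [scaleQuot, ← ENNReal.rpow_mul, one_div_mul_eq_div]
  constructor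
  · have hle : (∫⁻ x, ⨆ (ρ : ℝ) (_ : 0 < ρ), (embC n α p q σ (ball x ρ) ^ γ /
        ENNReal.ofReal (ρ ^ d)) ^ (r / (p - 1))) ≤ B * ∫⁻ x, intK n α p q σ x ^ r := by
      rw [← lintegral_const_mul' _ _ hB]
      refine lintegral_mono fun x => iSup₂_le fun ρ hρ => ?_
      rw [← hpow, ← ENNReal.mul_rpow_of_nonneg _ _ hr0.le]
      exact ENNReal.rpow_le_rpow (scaleQuot_le_lintegral hs hd0.le
        (fun ρ ρ' h => hmono x x ρ ρ' (by simpa using h)) hρ) hr0.le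
    have hcB : ENNReal.ofReal (B.toReal + 1)⁻¹ * B ≤ 1 := by
      rw [← ENNReal.ofReal_toReal hB, ENNReal.toReal_ofReal ENNReal.toReal_nonneg,
        ← ENNReal.ofReal_mul (by positivity), ENNReal.ofReal_le_one, inv_mul_le_one₀ hB0]
      linarith
    refine (mul_le_mul_right hle _).trans ?_
    rw [← mul_assoc]
    exact mul_le_of_le_one_left' hcB
  · set M : EuclideanSpace ℝ (Fin n) → ℝ≥0∞ := fun x =>
      (⨆ (ρ : ℝ) (_ : 0 < ρ), scaleQuot f d (p - 1) x ρ ^ r) ^ (1 / r)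
    have hM : ∀ x ρ, 0 < ρ → scaleQuot f d (p - 1) x ρ ≤ M x := by
      intro x ρ hρ
      simp only [M]
      rw [one_div, ENNReal.le_rpow_inv_iff hr0]
      exact le_iSup₂_of_le (f := fun (ρ : ℝ) (_ : 0 < ρ) => scaleQuot f d (p - 1) x ρ ^ r)
        ρ hρ le_rfl
    have hMr : ∀ x, M x ^ r = ⨆ (ρ : ℝ) (_ : 0 < ρ), (embC n α p q σ (ball x ρ) ^ γ /
        ENNReal.ofReal (ρ ^ d)) ^ (r / (p - 1)) := by
      intro x
      simp only [M, hpow]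
      rw [← ENNReal.rpow_mul, one_div_mul_cancel hr0.ne', ENNReal.rpow_one]
    calc ∫⁻ x, intK n α p q σ x ^ r ≤ C * ∫⁻ x, M x ^ r := hupper f hmono hmeas havg M hM
      _ ≤ _ := by
        simp only [hMr]
        gcongr
        rw [← ENNReal.ofReal_toReal hC]
        exact ENNReal.ofReal_le_ofReal (by simp)
end

section
/- Let n ≥ 1, 1 < p < ∞, 0 < q < p−1, 0 < α < n/p, and r ≥ n(p−1)/(n−αp), and let σ be a locally finite nonnegative Borel measure on ℝⁿ. Assume that ∫₁^∞ ( σ(B(0,ρ)) / ρ^{n−αp} )^{1/(p−1)} dρ/ρ < ∞ and that K_{α,p,q}σ ∈ L^r_loc(ℝⁿ). Then W_{α,p}σ ∈ L^{r(p−1)/(p−1−q)}_loc(ℝⁿ). -/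
open MeasureTheory Metric Set
open scoped ENNReal NNReal

/-- The index of the half-open dyadic cube of side length `2⁻ᵏ` containing `x`. -/
noncomputable def dyadicIndex {n : ℕ} (k : ℕ) (x : EuclideanSpace ℝ (Fin n)) : Fin n → ℤ :=
  fun i => ⌊(2 : ℝ) ^ k * x i⌋

/-- The union of the dyadic cube of side length `2⁻ᵏ` containing `x` and its neighbours. -/
def dyadicNhd {n : ℕ} (k : ℕ) (x : EuclideanSpace ℝ (Fin n)) : Set (EuclideanSpace ℝ (Fin n)) :=
  {y | ∀ i, |dyadicIndex k y i - dyadicIndex k x i| ≤ 1}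

section DyadicCubes

variable {n : ℕ}

theorem dyadicIndex_eq_ediv {j k : ℕ} (hjk : j ≤ k) (x : EuclideanSpace ℝ (Fin n)) (i : Fin n) :
    dyadicIndex j x i = dyadicIndex k x i / ((2 ^ (k - j) : ℕ) : ℤ) := by
  unfold dyadicIndex
  rw [← Int.floor_div_natCast]
  congr 1
  obtain ⟨m, rfl⟩ := Nat.exists_eq_add_of_le hjk
  rw [Nat.add_sub_cancel_left]
  push_cast
  field_simp
  ring

theorem factorsThrough_dyadicIndex {β : Type*} {f : EuclideanSpace ℝ (Fin n) → β} {j k : ℕ}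
    (hf : f.FactorsThrough (dyadicIndex j)) (hjk : j ≤ k) : f.FactorsThrough (dyadicIndex k) := by
  intro x y hxy
  refine hf (funext fun i => ?_)
  rw [dyadicIndex_eq_ediv hjk, dyadicIndex_eq_ediv hjk, hxy]

theorem dyadicNhd_subset {j k : ℕ} (hjk : j ≤ k) (x : EuclideanSpace ℝ (Fin n)) :
    dyadicNhd k x ⊆ dyadicNhd j x := by
  intro y hy i
  have h := hy i
  rw [dyadicIndex_eq_ediv hjk, dyadicIndex_eq_ediv hjk]
  have hd : (0 : ℤ) < ((2 ^ (k - j) : ℕ) : ℤ) := by positivity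
  generalize ((2 ^ (k - j) : ℕ) : ℤ) = d at hd
  generalize dyadicIndex k y i = a at h
  generalize dyadicIndex k x i = b at h
  rw [abs_le] at h ⊢
  have h1 : a / d ≤ (b + d) / d := Int.ediv_le_ediv hd (by linarith)
  have h2 : b / d ≤ (a + d) / d := Int.ediv_le_ediv hd (by linarith)
  rw [Int.add_ediv_of_dvd_right (dvd_refl d), Int.ediv_self hd.ne'] at h1 h2
  constructor <;> linarith

theorem mem_dyadicNhd_comm {k : ℕ} {x y : EuclideanSpace ℝ (Fin n)} :
    y ∈ dyadicNhd k x ↔ x ∈ dyadicNhd k y := by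
  simp only [dyadicNhd, mem_ofPred_eq, abs_sub_comm]

theorem measurable_dyadicIndex (k : ℕ) :
    Measurable (dyadicIndex k : EuclideanSpace ℝ (Fin n) → Fin n → ℤ) := by
  refine measurable_pi_lambda _ fun i => Int.measurable_floor.comp ?_
  fun_prop

theorem measurable_of_factorsThrough_dyadicIndex {k : ℕ} {β : Type*} [MeasurableSpace β]
    [Nonempty β]
    {f : EuclideanSpace ℝ (Fin n) → β} (hf : f.FactorsThrough (dyadicIndex k)) :
    Measurable f := by
  obtain ⟨g, rfl⟩ := (Function.factorsThrough_iff f).1 hf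
  exact (Measurable.of_discrete (f := g)).comp (measurable_dyadicIndex k)

theorem volume_box (a b : Fin n → ℝ) :
    volume {x : EuclideanSpace ℝ (Fin n) | ∀ i, x i ∈ Ico (a i) (b i)} =
      ∏ i, ENNReal.ofReal (b i - a i) := by
  rw [← Real.volume_pi_Ico, ← (PiLp.volume_preserving_ofLp (Fin n)).measure_preimage
    (MeasurableSet.univ_pi fun i => measurableSet_Ico).nullMeasurableSet]
  congr 1
  ext x
  simp

theorem volume_dyadicCube (k : ℕ) (m : Fin n → ℤ) :
    volume {x : EuclideanSpace ℝ (Fin n) | dyadicIndex k x = m} = ((2 : ℝ≥0∞) ^ (k * n))⁻¹ := by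
  have h : {x : EuclideanSpace ℝ (Fin n) | dyadicIndex k x = m} =
      {x | ∀ i, x i ∈ Ico ((m i : ℝ) / 2 ^ k) ((m i + 1 : ℝ) / 2 ^ k)} := by
    ext x
    simp only [mem_ofPred_eq, funext_iff, dyadicIndex, Int.floor_eq_iff, mem_Ico]
    refine forall_congr' fun i => ?_
    rw [div_le_iff₀' (by positivity), lt_div_iff₀' (by positivity)]
  rw [h, volume_box]
  have h2 : ∀ i, ENNReal.ofReal ((m i + 1 : ℝ) / 2 ^ k - (m i : ℝ) / 2 ^ k) =
      ((2 : ℝ≥0∞) ^ k)⁻¹ := by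
    intro i
    rw [← sub_div, add_sub_cancel_left, one_div, ENNReal.ofReal_inv_of_pos (by positivity),
      ENNReal.ofReal_pow (by norm_num), ENNReal.ofReal_ofNat]
  simp [h2, pow_mul, ENNReal.inv_pow]

theorem volume_dyadicNhd (k : ℕ) (y : EuclideanSpace ℝ (Fin n)) :
    volume (dyadicNhd k y) = 3 ^ n * ((2 : ℝ≥0∞) ^ (k * n))⁻¹ := by
  have h : dyadicNhd k y =
      {x | ∀ i, x i ∈ Ico ((dyadicIndex k y i - 1 : ℝ) / 2 ^ k)
        ((dyadicIndex k y i + 2 : ℝ) / 2 ^ k)} := by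
    ext x
    simp only [mem_ofPred_eq, dyadicNhd, mem_Ico]
    refine forall_congr' fun i => ?_
    rw [div_le_iff₀' (by positivity), lt_div_iff₀' (by positivity)]
    generalize dyadicIndex k y i = m
    rw [abs_le, dyadicIndex]
    have h1 : ((m : ℝ) - 1 ≤ 2 ^ k * x i) ↔ m - 1 ≤ ⌊(2 : ℝ) ^ k * x i⌋ := by
      rw [Int.le_floor]; push_cast; rfl
    have h2 : (2 ^ k * x i < (m : ℝ) + 2) ↔ ⌊(2 : ℝ) ^ k * x i⌋ < m + 2 := by
      rw [Int.floor_lt]; push_cast; rfl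
    rw [h1, h2]
    constructor <;> rintro ⟨h3, h4⟩ <;> constructor <;> linarith
  rw [h, volume_box]
  have h2 : ∀ i, ENNReal.ofReal ((dyadicIndex k y i + 2 : ℝ) / 2 ^ k -
      (dyadicIndex k y i - 1 : ℝ) / 2 ^ k) = 3 * ((2 : ℝ≥0∞) ^ k)⁻¹ := by
    intro i
    rw [← sub_div, show (dyadicIndex k y i + 2 : ℝ) - (dyadicIndex k y i - 1) = 3 by ring,
      div_eq_mul_inv, ENNReal.ofReal_mul (by norm_num), ENNReal.ofReal_inv_of_pos (by positivity),
      ENNReal.ofReal_pow (by norm_num), ENNReal.ofReal_ofNat, ENNReal.ofReal_ofNat]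
  simp [h2, pow_mul, ENNReal.inv_pow, mul_pow]

theorem measurableSet_mem_dyadicNhd (k : ℕ) :
    MeasurableSet {z : EuclideanSpace ℝ (Fin n) × EuclideanSpace ℝ (Fin n) |
      z.2 ∈ dyadicNhd k z.1} := by
  have h : Measurable fun z : EuclideanSpace ℝ (Fin n) × EuclideanSpace ℝ (Fin n) =>
      (dyadicIndex k z.1, dyadicIndex k z.2) :=
    ((measurable_dyadicIndex k).comp measurable_fst).prodMk
      ((measurable_dyadicIndex k).comp measurable_snd)
  exact h (MeasurableSet.of_discrete
    (s := {w : (Fin n → ℤ) × (Fin n → ℤ) | ∀ i, |w.2 i - w.1 i| ≤ 1}))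

theorem measurableSet_dyadicNhd (k : ℕ) (x : EuclideanSpace ℝ (Fin n)) :
    MeasurableSet (dyadicNhd k x) :=
  measurable_prodMk_left (measurableSet_mem_dyadicNhd k)

theorem lintegral_eq_tsum_dyadicIndex (k : ℕ) (g : (Fin n → ℤ) → ℝ≥0∞) :
    ∫⁻ x : EuclideanSpace ℝ (Fin n), g (dyadicIndex k x) =
      ((2 : ℝ≥0∞) ^ (k * n))⁻¹ * ∑' m, g m := by
  rw [← lintegral_map (Measurable.of_discrete (f := g)) (measurable_dyadicIndex k),
    lintegral_countable', ← ENNReal.tsum_mul_left]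
  refine tsum_congr fun m => ?_
  rw [Measure.map_apply (measurable_dyadicIndex k) (MeasurableSet.singleton m), mul_comm]
  congr 1
  exact volume_dyadicCube k m

theorem lintegral_mul_measure_dyadicNhd_eq (σ : Measure (EuclideanSpace ℝ (Fin n))) [SFinite σ]
    {D : EuclideanSpace ℝ (Fin n) → ℝ≥0∞} (hD : Measurable D) (k : ℕ) :
    ∫⁻ x, D x * σ (dyadicNhd k x) =
      ∫⁻ y, (∫⁻ x, D x * (dyadicNhd k y).indicator 1 x) ∂σ := by
  have h : ∀ x, D x * σ (dyadicNhd k x) =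
      ∫⁻ y, D x * (dyadicNhd k y).indicator 1 x ∂σ := by
    intro x
    have h1 : ∀ y, (dyadicNhd k y).indicator (1 : EuclideanSpace ℝ (Fin n) → ℝ≥0∞) x =
        (dyadicNhd k x).indicator 1 y := by
      intro y
      have := mem_dyadicNhd_comm (k := k) (x := x) (y := y)
      by_cases hy : y ∈ dyadicNhd k x
      · rw [indicator_of_mem hy, indicator_of_mem (this.1 hy)]
        rfl
      · rw [indicator_of_notMem hy, indicator_of_notMem (mt this.2 hy)]
    simp_rw [h1]
    rw [lintegral_const_mul _ (measurable_one.indicator (measurableSet_dyadicNhd k x)),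
      lintegral_indicator_one (measurableSet_dyadicNhd k x)]
  simp_rw [h]
  refine lintegral_lintegral_swap (Measurable.aemeasurable ?_)
  refine (hD.comp measurable_fst).mul ?_
  have h2 : (fun z : EuclideanSpace ℝ (Fin n) × EuclideanSpace ℝ (Fin n) =>
      (dyadicNhd k z.2).indicator (1 : EuclideanSpace ℝ (Fin n) → ℝ≥0∞) z.1) =
      {z | z.2 ∈ dyadicNhd k z.1}.indicator 1 := by
    ext z
    have := mem_dyadicNhd_comm (k := k) (x := z.1) (y := z.2)
    by_cases hz : z.2 ∈ dyadicNhd k z.1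
    · rw [indicator_of_mem (this.1 hz), indicator_of_mem (by exact hz)]
      rfl
    · rw [indicator_of_notMem (mt this.2 hz), indicator_of_notMem (by exact hz)]
  exact h2 ▸ measurable_one.indicator (measurableSet_mem_dyadicNhd k)

theorem lintegral_mul_measure_dyadicNhd_le (σ : Measure (EuclideanSpace ℝ (Fin n))) [SFinite σ]
    {D : EuclideanSpace ℝ (Fin n) → ℝ≥0∞} {j k : ℕ} (hD : D.FactorsThrough (dyadicIndex j))
    (hjk : j ≤ k) :
    ((2 : ℝ≥0∞) ^ (k * n)) * ∫⁻ x, D x * σ (dyadicNhd k x) ≤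
      3 ^ n * (2 ^ (j * n) * ∫⁻ x, D x * σ (dyadicNhd j x)) := by
  have hDm := measurable_of_factorsThrough_dyadicIndex hD
  have h2 : ∀ i : ℕ, (2 : ℝ≥0∞) ^ (i * n) ≠ 0 := fun i => by positivity
  have h2' : ∀ i : ℕ, (2 : ℝ≥0∞) ^ (i * n) ≠ ⊤ := fun i => by finiteness
  rw [lintegral_mul_measure_dyadicNhd_eq σ hDm, lintegral_mul_measure_dyadicNhd_eq σ hDm,
    ← lintegral_const_mul' _ _ (h2' k), ← lintegral_const_mul' _ _ (h2' j),
    ← lintegral_const_mul' _ _ (by finiteness)]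
  refine lintegral_mono fun y => ?_
  obtain ⟨g, rfl⟩ := (Function.factorsThrough_iff D).1 hD
  set A : Set (Fin n → ℤ) := {m | ∀ i, |m i - dyadicIndex j y i| ≤ 1} with hA
  have hj : ∫⁻ x, (g ∘ dyadicIndex j) x * (dyadicNhd j y).indicator 1 x =
      ((2 : ℝ≥0∞) ^ (j * n))⁻¹ * ∑' m, g m * A.indicator 1 m := by
    rw [← lintegral_eq_tsum_dyadicIndex]
    rfl
  have hk : ∫⁻ x, (g ∘ dyadicIndex j) x * (dyadicNhd k y).indicator 1 x ≤
      (∑' m, g m * A.indicator 1 m) * (3 ^ n * ((2 : ℝ≥0∞) ^ (k * n))⁻¹) := by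
    rw [← volume_dyadicNhd k y, ← lintegral_indicator_one (measurableSet_dyadicNhd k y),
      ← lintegral_const_mul _ (measurable_one.indicator (measurableSet_dyadicNhd k y))]
    refine lintegral_mono fun x => ?_
    by_cases hx : x ∈ dyadicNhd k y
    · simp only [indicator_of_mem hx, Pi.one_apply, mul_one, Function.comp_apply]
      have hxA : dyadicIndex j x ∈ A := dyadicNhd_subset hjk y hx
      refine le_trans (le_of_eq ?_) (ENNReal.le_tsum (dyadicIndex j x))
      simp [indicator_of_mem hxA]
    · simp [indicator_of_notMem hx]
  rw [hj, ← mul_assoc (2 ^ (j * n)), ENNReal.mul_inv_cancel (h2 j) (h2' j), one_mul]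
  calc _ ≤ _ := mul_le_mul_right hk _
    _ = 2 ^ (k * n) * (2 ^ (k * n))⁻¹ * (3 ^ n * ∑' m, g m * A.indicator 1 m) := by ring
    _ = _ := by rw [ENNReal.mul_inv_cancel (h2 k) (h2' k), one_mul]

end DyadicCubes

section ENNRealInequalities

theorem ENNReal.rpow_ne_zero_of_ne_zero_of_ne_top {x : ℝ≥0∞} (h0 : x ≠ 0) (ht : x ≠ ⊤) (y : ℝ) :
    x ^ y ≠ 0 :=
  (ENNReal.rpow_pos (pos_iff_ne_zero.2 h0) ht).ne'

theorem ENNReal.rpow_le_rpow_add_rpow_sub_one_mul {X y : ℝ≥0∞} {η : ℝ} (hη0 : 0 < η)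
    (hη1 : η ≤ 1) (hX : X ≠ ⊤) (hy : X = 0 → y = 0) :
    y ^ η ≤ X ^ η + X ^ (η - 1) * y := by
  rcases eq_or_ne X 0 with h0 | h0
  · simp [hy h0, ENNReal.zero_rpow_of_pos hη0]
  rcases le_total y X with h | h
  · exact (ENNReal.rpow_le_rpow h hη0.le).trans le_self_add
  refine le_trans ?_ le_add_self
  rcases eq_or_ne y ⊤ with rfl | hyt
  · rw [ENNReal.mul_top]
    · exact le_top
    · simp [ENNReal.rpow_eq_zero_iff, h0, hX]
  have hy0 : y ≠ 0 := (lt_of_lt_of_le (pos_iff_ne_zero.2 h0) h).ne'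
  calc y ^ η = y ^ (η - 1) * y := by
        conv_rhs => rw [← ENNReal.rpow_one y, ← ENNReal.rpow_mul, ← ENNReal.rpow_add _ _ hy0 hyt]
        congr 1; ring
    _ ≤ X ^ (η - 1) * y := by
        rw [← neg_sub, ENNReal.rpow_neg, ENNReal.rpow_neg]
        gcongr

theorem Real.one_le_one_sub_rpow_add {u t θ : ℝ} (hu0 : 0 ≤ u) (hu1 : u ≤ 1) (ht : 0 < t)
    (hθ0 : 0 < θ) (hθ1 : θ ≤ 1) : 1 ≤ (1 - u) ^ t + (t + 1) * u ^ θ := by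
  have h1 : u ≤ u ^ θ := by
    simpa using Real.rpow_le_rpow_of_exponent_ge' hu0 hu1 hθ0.le hθ1
  rcases le_total 1 t with h | h
  · have h2 := one_add_mul_self_le_rpow_one_add (s := -u) (by linarith) h
    rw [← sub_eq_add_neg] at h2
    nlinarith
  · have h2 : 1 - u ≤ (1 - u) ^ t := by
      simpa using Real.rpow_le_rpow_of_exponent_ge' (x := 1 - u) (by linarith) (by linarith) ht.le h
    nlinarith

theorem ENNReal.add_rpow_le_rpow_add_mul_s10 {x a : ℝ≥0∞} {t θ : ℝ} (ht : 0 < t) (hθ0 : 0 < θ)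
    (hθ1 : θ ≤ 1) (hx : x ≠ ⊤) (ha : a ≠ ⊤) :
    (x + a) ^ t ≤ x ^ t + ENNReal.ofReal (t + 1) * (a ^ θ * (x + a) ^ (t - θ)) := by
  rcases eq_or_ne (x + a) 0 with h0 | h0
  · simp [h0, ENNReal.zero_rpow_of_pos ht]
  have htop : x + a ≠ ⊤ := by finiteness
  set u : ℝ≥0∞ := a / (x + a) with hu
  have hu1 : u ≤ 1 := ENNReal.div_le_of_le_mul (by simp)
  have hut : u ≠ ⊤ := ne_top_of_le_ne_top ENNReal.one_ne_top hu1
  have ha' : a = u * (x + a) := (ENNReal.div_mul_cancel h0 htop).symm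
  have hx' : x = (1 - u) * (x + a) := by
    rw [ENNReal.sub_mul (fun _ _ => htop), ← ha', one_mul]
    exact (ENNReal.add_sub_cancel_right ha).symm
  have key : (1 : ℝ≥0∞) ≤ (1 - u) ^ t + ENNReal.ofReal (t + 1) * u ^ θ := by
    have hur : u.toReal ≤ 1 := by simpa using ENNReal.toReal_mono ENNReal.one_ne_top hu1
    have h := Real.one_le_one_sub_rpow_add (u := u.toReal) ENNReal.toReal_nonneg hur ht hθ0 hθ1
    rw [← ENNReal.ofReal_toReal hut, ← ENNReal.ofReal_one, ← ENNReal.ofReal_sub _ (by positivity),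
      ENNReal.ofReal_rpow_of_nonneg (by linarith) ht.le,
      ENNReal.ofReal_rpow_of_nonneg (by positivity) hθ0.le, ← ENNReal.ofReal_mul (by positivity),
      ← ENNReal.ofReal_add (Real.rpow_nonneg (by linarith) _) (by positivity)]
    exact ENNReal.ofReal_le_ofReal h
  generalize x + a = y at *
  calc y ^ t ≤ ((1 - u) ^ t + ENNReal.ofReal (t + 1) * u ^ θ) * y ^ t :=
        le_mul_of_one_le_left' key
    _ = ((1 - u) * y) ^ t + ENNReal.ofReal (t + 1) * ((u * y) ^ θ * y ^ (t - θ)) := by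
        rw [ENNReal.mul_rpow_of_nonneg _ _ ht.le, ENNReal.mul_rpow_of_nonneg _ _ hθ0.le, add_mul,
          mul_assoc (u ^ θ), ← ENNReal.rpow_add _ _ h0 htop, add_sub_cancel, mul_assoc]
    _ = _ := by rw [← hx', ← ha']

theorem ENNReal.le_rpow_mul_of_le_mul_rpow {I J C : ℝ≥0∞} {a : ℝ} (ha0 : 0 < a)
    (hI : I ≠ ⊤) (h : I ≤ C * (I ^ (1 - a) * J ^ a)) : I ≤ C ^ (1 / a) * J := by
  rcases eq_or_ne I 0 with rfl | h0
  · exact zero_le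
  have h1 : I ^ a ≤ C * J ^ a := by
    have hI1 : I ^ (a - 1) ≠ ⊤ := by simp [ENNReal.rpow_eq_top_iff, h0, hI]
    calc I ^ a = I ^ (a - 1) * I := by
          conv_rhs => rw [← ENNReal.rpow_one I, ← ENNReal.rpow_mul, ← ENNReal.rpow_add _ _ h0 hI]
          congr 1; ring
      _ ≤ I ^ (a - 1) * (C * (I ^ (1 - a) * J ^ a)) := mul_le_mul_right h _
      _ = (I ^ (a - 1) * I ^ (1 - a)) * (C * J ^ a) := by ring
      _ = C * J ^ a := by
          rw [← ENNReal.rpow_add _ _ h0 hI]; simp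
  have h2 := ENNReal.rpow_le_rpow h1 (one_div_pos.2 ha0).le
  rwa [ENNReal.mul_rpow_of_nonneg _ _ (one_div_pos.2 ha0).le, ← ENNReal.rpow_mul,
    ← ENNReal.rpow_mul, mul_one_div_cancel ha0.ne', ENNReal.rpow_one, ENNReal.rpow_one] at h2

theorem ENNReal.le_sum_range_succ_tsub (f : ℕ → ℝ≥0∞) (h0 : f 0 = 0) (k : ℕ) :
    f k ≤ ∑ j ∈ Finset.range k, (f (j + 1) - f j) := by
  induction k with
  | zero => simp [h0]
  | succ k ih =>
    rw [Finset.sum_range_succ]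
    exact le_tsub_add.trans ((add_comm _ _).trans_le (add_le_add_left ih _))

theorem ENNReal.sum_range_succ_tsub_le (f : ℕ → ℝ≥0∞) (hf : Monotone f) (k : ℕ) :
    ∑ j ∈ Finset.range k, (f (j + 1) - f j) ≤ f k := by
  induction k with
  | zero => simp
  | succ k ih =>
    rw [Finset.sum_range_succ]
    exact (add_le_add_left ih _).trans (add_tsub_cancel_of_le (hf k.le_succ)).le

end ENNRealInequalities

/-- The density `σ(Q*) / ℓ(Q)ᴺ`, where `Q` is the dyadic cube of side length `ℓ(Q) = 2⁻ᵏ`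
containing `x` and `Q*` is the union of `Q` and its neighbours. -/
noncomputable def dyadicDensity {n : ℕ} (σ : Measure (EuclideanSpace ℝ (Fin n))) (N : ℝ) (k : ℕ)
    (x : EuclideanSpace ℝ (Fin n)) : ℝ≥0∞ :=
  σ (dyadicNhd k x) * 2 ^ (k * N)

section DyadicDensity

variable {n : ℕ} {σ : Measure (EuclideanSpace ℝ (Fin n))} {N : ℝ}

theorem factorsThrough_dyadicDensity (k : ℕ) :
    (dyadicDensity σ N k).FactorsThrough (dyadicIndex k) := by
  intro x y hxy
  simp only [dyadicDensity, dyadicNhd, hxy]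

theorem norm_lt_of_forall_abs_lt (hn : 1 ≤ n) {x : EuclideanSpace ℝ (Fin n)} {c : ℝ}
    (h : ∀ i, |x i| < c) : ‖x‖ < n * c := by
  have hc : 0 < c := (abs_nonneg _).trans_lt (h ⟨0, hn⟩)
  have hn' : (1 : ℝ) ≤ n := by exact_mod_cast hn
  rw [EuclideanSpace.norm_eq, Real.sqrt_lt' (by positivity)]
  calc ∑ i, ‖x i‖ ^ 2 < ∑ i : Fin n, c ^ 2 := by
        refine Finset.sum_lt_sum_of_nonempty ⟨⟨0, hn⟩, Finset.mem_univ _⟩ fun i _ => ?_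
        have := h i
        rw [Real.norm_eq_abs]
        gcongr
    _ = n * c ^ 2 := by simp
    _ ≤ (n * c) ^ 2 := by nlinarith [sq_nonneg c]

theorem dyadicNhd_subset_ball (hn : 1 ≤ n) (k : ℕ) (x : EuclideanSpace ℝ (Fin n)) :
    dyadicNhd k x ⊆ ball x (2 * n / 2 ^ k) := by
  intro y hy
  rw [mem_ball, dist_eq_norm, show (2 * n / 2 ^ k : ℝ) = n * (2 / 2 ^ k) by ring]
  refine norm_lt_of_forall_abs_lt hn fun i => ?_
  have h := hy i
  rw [dyadicIndex, dyadicIndex, abs_le] at h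
  have h1 := Int.floor_le ((2 : ℝ) ^ k * y i)
  have h2 := Int.lt_floor_add_one ((2 : ℝ) ^ k * y i)
  have h3 := Int.floor_le ((2 : ℝ) ^ k * x i)
  have h4 := Int.lt_floor_add_one ((2 : ℝ) ^ k * x i)
  have h5 : ((⌊(2 : ℝ) ^ k * y i⌋ : ℝ) - ⌊(2 : ℝ) ^ k * x i⌋) ≤ 1 := by exact_mod_cast h.2
  have h6 : -1 ≤ ((⌊(2 : ℝ) ^ k * y i⌋ : ℝ) - ⌊(2 : ℝ) ^ k * x i⌋) := by exact_mod_cast h.1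
  rw [PiLp.sub_apply, lt_div_iff₀' (by positivity)]
  nth_rw 1 [← abs_of_pos (a := (2 : ℝ) ^ k) (by positivity)]
  rw [← abs_mul, abs_lt, mul_sub]
  constructor <;> linarith

theorem ball_subset_dyadicNhd (k : ℕ) (x : EuclideanSpace ℝ (Fin n)) :
    ball x (1 / 2 ^ k) ⊆ dyadicNhd k x := by
  intro y hy i
  have h0 : |y i - x i| < 1 / 2 ^ k := by
    rw [mem_ball, dist_eq_norm] at hy
    exact lt_of_le_of_lt (by simpa using PiLp.norm_apply_le (y - x) i) hy
  rw [lt_div_iff₀' (by positivity)] at h0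
  nth_rw 1 [← abs_of_pos (a := (2 : ℝ) ^ k) (by positivity)] at h0
  rw [← abs_mul, abs_lt, mul_sub] at h0
  rw [dyadicIndex, dyadicIndex, abs_le]
  have h1 := Int.floor_le ((2 : ℝ) ^ k * y i)
  have h2 := Int.lt_floor_add_one ((2 : ℝ) ^ k * y i)
  have h3 := Int.floor_le ((2 : ℝ) ^ k * x i)
  have h4 := Int.lt_floor_add_one ((2 : ℝ) ^ k * x i)
  have h5 : ((⌊(2 : ℝ) ^ k * y i⌋ : ℝ)) < ⌊(2 : ℝ) ^ k * x i⌋ + 2 := by linarith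
  have h6 : ((⌊(2 : ℝ) ^ k * x i⌋ : ℝ)) < ⌊(2 : ℝ) ^ k * y i⌋ + 2 := by linarith
  have h5' : ⌊(2 : ℝ) ^ k * y i⌋ < ⌊(2 : ℝ) ^ k * x i⌋ + 2 := by exact_mod_cast h5
  have h6' : ⌊(2 : ℝ) ^ k * x i⌋ < ⌊(2 : ℝ) ^ k * y i⌋ + 2 := by exact_mod_cast h6
  constructor <;> linarith

theorem measure_dyadicNhd_ne_top [IsLocallyFiniteMeasure σ] (hn : 1 ≤ n) (k : ℕ)
    (x : EuclideanSpace ℝ (Fin n)) : σ (dyadicNhd k x) ≠ ⊤ :=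
  ((measure_mono (dyadicNhd_subset_ball hn k x)).trans_lt measure_ball_lt_top).ne

theorem dyadicDensity_ne_top [IsLocallyFiniteMeasure σ] (hn : 1 ≤ n) (k : ℕ)
    (x : EuclideanSpace ℝ (Fin n)) : dyadicDensity σ N k x ≠ ⊤ :=
  ENNReal.mul_ne_top (measure_dyadicNhd_ne_top hn k x)
    (ENNReal.rpow_ne_top_of_ne_zero (by simp) (by simp))

theorem lintegral_mul_dyadicDensity_le [SFinite σ] {D : EuclideanSpace ℝ (Fin n) → ℝ≥0∞}
    {j k : ℕ} (hD : D.FactorsThrough (dyadicIndex j)) (hjk : j ≤ k) :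
    ∫⁻ x, D x * dyadicDensity σ N k x ≤
      3 ^ n * ((2 ^ (N - n) : ℝ≥0∞) ^ (k - j) * ∫⁻ x, D x * dyadicDensity σ N j x) := by
  have h := lintegral_mul_measure_dyadicNhd_le σ hD hjk
  have htop : ∀ a : ℝ, (2 : ℝ≥0∞) ^ a ≠ ⊤ := fun a =>
    ENNReal.rpow_ne_top_of_ne_zero (by simp) (by simp)
  have hI : ∀ i, ∫⁻ x, D x * dyadicDensity σ N i x =
      2 ^ (i * N) * ∫⁻ x, D x * σ (dyadicNhd i x) := by
    intro i
    rw [← lintegral_const_mul' _ _ (htop _)]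
    refine lintegral_congr fun x => ?_
    rw [dyadicDensity]; ring
  have hadd : ∀ a b : ℝ, (2 : ℝ≥0∞) ^ (a + b) = 2 ^ a * 2 ^ b := fun a b =>
    ENNReal.rpow_add _ _ (by simp) (by simp)
  rw [hI, hI]
  have e1 : (2 : ℝ≥0∞) ^ (k * N) = 2 ^ (k * (N - n)) * 2 ^ (k * n) := by
    rw [← ENNReal.rpow_natCast 2 (k * n), ← hadd]; push_cast; congr 1; ring
  have e2 : (2 ^ (N - n) : ℝ≥0∞) ^ (k - j) * 2 ^ (j * N) = 2 ^ (k * (N - n)) * 2 ^ (j * n) := by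
    rw [← ENNReal.rpow_natCast 2 (j * n), ← hadd, ← ENNReal.rpow_natCast, ← ENNReal.rpow_mul,
      ← hadd, Nat.cast_sub hjk]
    push_cast; congr 1; ring
  calc _ = 2 ^ (k * (N - n)) * (2 ^ (k * n) * ∫⁻ x, D x * σ (dyadicNhd k x)) := by
        rw [e1, mul_assoc]
    _ ≤ 2 ^ (k * (N - n)) * (3 ^ n * (2 ^ (j * n) * ∫⁻ x, D x * σ (dyadicNhd j x))) :=
        mul_le_mul_right h _
    _ = 3 ^ n * ((2 ^ (k * (N - n)) * 2 ^ (j * n)) * ∫⁻ x, D x * σ (dyadicNhd j x)) := by ring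
    _ = _ := by rw [← e2]; ring

theorem lintegral_mul_dyadicDensity_rpow_le [IsLocallyFiniteMeasure σ] (hn : 1 ≤ n)
    {D : EuclideanSpace ℝ (Fin n) → ℝ≥0∞} {η : ℝ} (hη0 : 0 < η) (hη1 : η ≤ 1)
    {j k : ℕ} (hD : D.FactorsThrough (dyadicIndex j)) (hjk : j ≤ k) :
    ∫⁻ x, D x * dyadicDensity σ N k x ^ η ≤
      (1 + 3 ^ n) * (((2 ^ (N - n) : ℝ≥0∞) ^ η) ^ (k - j) *
        ∫⁻ x, D x * dyadicDensity σ N j x ^ η) := by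
  have htop : ∀ a : ℝ, (2 : ℝ≥0∞) ^ a ≠ ⊤ := fun a =>
    ENNReal.rpow_ne_top_of_ne_zero (by simp) (by simp)
  have hpos : ∀ a : ℝ, (2 : ℝ≥0∞) ^ a ≠ 0 := fun a => by
    simp [ENNReal.rpow_eq_zero_iff]
  set e : ℝ≥0∞ := (2 ^ (N - n) : ℝ≥0∞) ^ (k - j) with he
  have he0 : e ≠ 0 := pow_ne_zero _ (hpos _)
  have het : e ≠ ⊤ := ENNReal.pow_ne_top (htop _)
  have heη : ((2 ^ (N - n) : ℝ≥0∞) ^ η) ^ (k - j) = e ^ η := by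
    rw [he, ← ENNReal.rpow_natCast, ← ENNReal.rpow_mul, mul_comm η, ENNReal.rpow_mul,
      ENNReal.rpow_natCast]
  have heηt : e ^ η ≠ ⊤ := ENNReal.rpow_ne_top_of_nonneg hη0.le het
  set X : EuclideanSpace ℝ (Fin n) → ℝ≥0∞ := fun x => e * dyadicDensity σ N j x with hX
  have hXt : ∀ x, X x ≠ ⊤ := fun x => ENNReal.mul_ne_top het (dyadicDensity_ne_top hn j x)
  have hXD : X.FactorsThrough (dyadicIndex j) := fun x y hxy => by
    simp only [hX, factorsThrough_dyadicDensity j hxy]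
  have hpt : ∀ x, dyadicDensity σ N k x ^ η ≤
      X x ^ η + X x ^ (η - 1) * dyadicDensity σ N k x := by
    intro x
    refine ENNReal.rpow_le_rpow_add_rpow_sub_one_mul hη0 hη1 (hXt x) fun h => ?_
    have h1 : σ (dyadicNhd j x) = 0 := by
      simpa [hX, he0, dyadicDensity, hpos] using h
    have h2 : σ (dyadicNhd k x) = 0 := measure_mono_null (dyadicNhd_subset hjk x) h1
    simp [dyadicDensity, h2]
  have hXη : ∀ x, X x ^ (η - 1) * X x ≤ X x ^ η := by
    intro x
    rcases eq_or_ne (X x) 0 with h | h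
    · simp [h]
    · nth_rw 2 [← ENNReal.rpow_one (X x)]
      rw [← ENNReal.rpow_add _ _ h (hXt x), sub_add_cancel]
  have hDX : (fun x => D x * X x ^ (η - 1)).FactorsThrough (dyadicIndex j) := fun x y hxy => by
    simp only [hD hxy, hXD hxy]
  have hDX' : (fun x => D x * X x ^ η).FactorsThrough (dyadicIndex j) := fun x y hxy => by
    simp only [hD hxy, hXD hxy]
  have hI : ∫⁻ x, D x * X x ^ η = e ^ η * ∫⁻ x, D x * dyadicDensity σ N j x ^ η := by
    rw [← lintegral_const_mul' _ _ heηt]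
    refine lintegral_congr fun x => ?_
    simp only [hX, ENNReal.mul_rpow_of_nonneg _ _ hη0.le]
    ring
  calc ∫⁻ x, D x * dyadicDensity σ N k x ^ η
      ≤ ∫⁻ x, (D x * X x ^ η + (D x * X x ^ (η - 1)) * dyadicDensity σ N k x) :=
        lintegral_mono fun x => (mul_le_mul_right (hpt x) _).trans_eq (by ring)
    _ = (∫⁻ x, D x * X x ^ η) + ∫⁻ x, (D x * X x ^ (η - 1)) * dyadicDensity σ N k x :=
        lintegral_add_left (measurable_of_factorsThrough_dyadicIndex hDX') _
    _ ≤ (∫⁻ x, D x * X x ^ η) +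
          3 ^ n * (e * ∫⁻ x, (D x * X x ^ (η - 1)) * dyadicDensity σ N j x) := by
        gcongr
        exact lintegral_mul_dyadicDensity_le hDX hjk
    _ ≤ (∫⁻ x, D x * X x ^ η) + 3 ^ n * ∫⁻ x, D x * X x ^ η := by
        gcongr
        rw [← lintegral_const_mul' _ _ het]
        refine lintegral_mono fun x => ?_
        calc _ = D x * (X x ^ (η - 1) * X x) := by simp only [hX]; ring
          _ ≤ _ := mul_le_mul_right (hXη x) _
    _ = _ := by rw [hI, heη]; ring

end DyadicDensity

section MuckenhouptWheeden

variable {n : ℕ} {σ : Measure (EuclideanSpace ℝ (Fin n))} {N : ℝ}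

theorem factorsThrough_sum_dyadicDensity_rpow (s : ℝ) {j k : ℕ} (hjk : j ≤ k + 1) :
    (fun x => ∑ i ∈ Finset.range j, dyadicDensity σ N i x ^ s).FactorsThrough
      (dyadicIndex k) := by
  intro x y hxy
  refine Finset.sum_congr rfl fun i hi => ?_
  rw [factorsThrough_dyadicIndex (factorsThrough_dyadicDensity i)
    (Nat.lt_succ_iff.1 ((Finset.mem_range.1 hi).trans_le hjk)) hxy]

theorem measurableSet_dyadicIndex_mem (F : Set (Fin n → ℤ)) :
    MeasurableSet {x : EuclideanSpace ℝ (Fin n) | dyadicIndex 0 x ∈ F} :=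
  measurable_dyadicIndex 0 (MeasurableSet.of_discrete (s := F))

theorem setLIntegral_sum_dyadicDensity_rpow_ne_top [IsLocallyFiniteMeasure σ] (hn : 1 ≤ n)
    {s t : ℝ} (hs : 0 < s) (ht : 0 < t) (F : Finset (Fin n → ℤ)) (K : ℕ) :
    ∫⁻ x in {x | dyadicIndex 0 x ∈ (F : Set (Fin n → ℤ))},
      (∑ k ∈ Finset.range K, dyadicDensity σ N k x ^ s) ^ t ≠ ⊤ := by
  set B : EuclideanSpace ℝ (Fin n) → ℝ≥0∞ := fun x =>
    (∑ k ∈ Finset.range K, (σ (dyadicNhd 0 x) * 2 ^ (k * N)) ^ s) ^ t with hB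
  have hBD : B.FactorsThrough (dyadicIndex 0) := by
    intro x y hxy
    simp only [hB, dyadicNhd, hxy]
  have hBt : ∀ x, B x ≠ ⊤ := by
    intro x
    refine ENNReal.rpow_ne_top_of_nonneg ht.le (ENNReal.sum_ne_top.2 fun k _ => ?_)
    exact ENNReal.rpow_ne_top_of_nonneg hs.le (ENNReal.mul_ne_top
      (measure_dyadicNhd_ne_top hn 0 x) (ENNReal.rpow_ne_top_of_ne_zero (by simp) (by simp)))
  obtain ⟨g, hg⟩ := (Function.factorsThrough_iff B).1 hBD
  have hgt : ∀ m, g m ≠ ⊤ := by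
    intro m
    have hm : dyadicIndex 0 (WithLp.toLp 2 fun i => (m i : ℝ)) = m := by
      ext i; simp [dyadicIndex]
    have h := hBt (WithLp.toLp 2 fun i => (m i : ℝ))
    rwa [hg, Function.comp_apply, hm] at h
  have h1 : ∫⁻ x in {x | dyadicIndex 0 x ∈ (F : Set (Fin n → ℤ))},
      (∑ k ∈ Finset.range K, dyadicDensity σ N k x ^ s) ^ t ≤
      ∫⁻ x : EuclideanSpace ℝ (Fin n), (F : Set (Fin n → ℤ)).indicator g (dyadicIndex 0 x) := by
    rw [← lintegral_indicator (measurableSet_dyadicIndex_mem _)]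
    refine lintegral_mono fun x => ?_
    by_cases hx : dyadicIndex 0 x ∈ (F : Set (Fin n → ℤ))
    · rw [indicator_of_mem (by exact hx), indicator_of_mem hx,
        show g (dyadicIndex 0 x) = B x by rw [hg]; rfl]
      dsimp only [hB]
      refine ENNReal.rpow_le_rpow (Finset.sum_le_sum fun k _ => ENNReal.rpow_le_rpow ?_ hs.le) ht.le
      exact mul_le_mul_left (measure_mono (dyadicNhd_subset (Nat.zero_le k) x)) _
    · rw [indicator_of_notMem (by exact hx)]
      exact zero_le
  refine ne_top_of_le_ne_top ?_ h1
  rw [lintegral_eq_tsum_dyadicIndex]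
  refine ENNReal.mul_ne_top (by simp) ?_
  rw [tsum_eq_sum (s := F) fun m hm => indicator_of_notMem (by simpa using hm) _]
  refine ENNReal.sum_ne_top.2 fun m _ => ?_
  by_cases hm : m ∈ (F : Set (Fin n → ℤ))
  · rw [indicator_of_mem hm]; exact hgt m
  · rw [indicator_of_notMem hm]; exact ENNReal.zero_ne_top

theorem setLIntegral_mul_dyadicDensity_rpow_le [IsLocallyFiniteMeasure σ] (hn : 1 ≤ n)
    {D : EuclideanSpace ℝ (Fin n) → ℝ≥0∞} {η : ℝ} (hη0 : 0 < η) (hη1 : η ≤ 1)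
    {j k : ℕ} (hD : D.FactorsThrough (dyadicIndex j)) (hjk : j ≤ k) (F : Set (Fin n → ℤ)) :
    ∫⁻ x in {x | dyadicIndex 0 x ∈ F}, D x * dyadicDensity σ N k x ^ η ≤
      (1 + 3 ^ n) * (((2 ^ (N - n) : ℝ≥0∞) ^ η) ^ (k - j) *
        ∫⁻ x in {x | dyadicIndex 0 x ∈ F}, D x * dyadicDensity σ N j x ^ η) := by
  have hU := measurableSet_dyadicIndex_mem F
  have h : ({x | dyadicIndex 0 x ∈ F}.indicator D).FactorsThrough (dyadicIndex j) := by
    intro x y hxy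
    have h0 : dyadicIndex 0 x = dyadicIndex 0 y :=
      factorsThrough_dyadicIndex (f := dyadicIndex 0) (fun _ _ h => h) (Nat.zero_le j) hxy
    by_cases hx : dyadicIndex 0 x ∈ F
    · have hy : y ∈ {x | dyadicIndex 0 x ∈ F} := by
        change dyadicIndex 0 y ∈ F; rw [← h0]; exact hx
      rw [indicator_of_mem (by exact hx), indicator_of_mem hy, hD hxy]
    · have hy : y ∉ {x | dyadicIndex 0 x ∈ F} := by
        change dyadicIndex 0 y ∉ F; rw [← h0]; exact hx
      rw [indicator_of_notMem (by exact hx), indicator_of_notMem hy]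
  have := lintegral_mul_dyadicDensity_rpow_le (σ := σ) (N := N) hn hη0 hη1 h hjk
  rw [← lintegral_indicator hU, ← lintegral_indicator hU]
  simpa only [indicator_mul_left] using this

theorem exists_setLIntegral_sum_dyadicDensity_rpow_le (hn : 1 ≤ n) (hN : N < n) {s t : ℝ}
    (hs : 0 < s) (ht : 0 < t) :
    ∃ C : ℝ≥0∞, C ≠ ⊤ ∧ ∀ (σ : Measure (EuclideanSpace ℝ (Fin n))) [IsLocallyFiniteMeasure σ]
      (F : Finset (Fin n → ℤ)) (K : ℕ),
      ∫⁻ x in {x | dyadicIndex 0 x ∈ (F : Set (Fin n → ℤ))},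
        (∑ k ∈ Finset.range K, dyadicDensity σ N k x ^ s) ^ t ≤
      C * ∫⁻ x in {x | dyadicIndex 0 x ∈ (F : Set (Fin n → ℤ))},
        (⨆ k, dyadicDensity σ N k x ^ s) ^ t := by
  obtain ⟨θ, hθ0, hθ1, hθt, hθs⟩ : ∃ θ : ℝ, 0 < θ ∧ θ ≤ 1 ∧ θ < t ∧ s * θ ≤ 1 := by
    refine ⟨min (min 1 (t / 2)) (1 / s), by positivity, (min_le_left _ _).trans (min_le_left _ _),
      ?_, ?_⟩
    · have : min (min 1 (t / 2)) (1 / s) ≤ t / 2 := (min_le_left _ _).trans (min_le_right _ _)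
      linarith
    · have : min (min 1 (t / 2)) (1 / s) ≤ 1 / s := min_le_right _ _
      rwa [le_div_iff₀' hs] at this
  have hη0 : 0 < s * θ := by positivity
  set η := s * θ with hη
  set e : ℝ≥0∞ := (2 ^ (N - n) : ℝ≥0∞) ^ η with he
  have he1 : e < 1 := by
    rw [he, ← ENNReal.rpow_mul]
    exact ENNReal.rpow_lt_one_of_one_lt_of_neg (by norm_num)
      (mul_neg_of_neg_of_pos (by linarith) hη0)
  set G : ℝ≥0∞ := (1 - e)⁻¹ with hG
  have hGt : G ≠ ⊤ := by
    rw [hG, ENNReal.inv_ne_top]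
    exact (tsub_pos_of_lt he1).ne'
  set c : ℝ≥0∞ := ENNReal.ofReal (t + 1) * ((1 + 3 ^ n) * G) with hc
  have hct : c ≠ ⊤ := by finiteness
  refine ⟨c ^ (1 / (θ / t)), ENNReal.rpow_ne_top_of_nonneg (by positivity) hct, ?_⟩
  intro σ _ F K
  set U : Set (EuclideanSpace ℝ (Fin n)) := {x | dyadicIndex 0 x ∈ (F : Set (Fin n → ℤ))} with hU
  set a : ℕ → EuclideanSpace ℝ (Fin n) → ℝ≥0∞ := fun k x => dyadicDensity σ N k x ^ s with ha
  set P : ℕ → EuclideanSpace ℝ (Fin n) → ℝ≥0∞ := fun k x => ∑ i ∈ Finset.range k, a i x with hP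
  set M : EuclideanSpace ℝ (Fin n) → ℝ≥0∞ := fun x => ⨆ k, a k x with hM
  set D : ℕ → EuclideanSpace ℝ (Fin n) → ℝ≥0∞ := fun j x =>
    P (j + 1) x ^ (t - θ) - P j x ^ (t - θ) with hD
  have hβ : 0 < t - θ := by linarith
  have hat : ∀ k x, a k x ≠ ⊤ := fun k x =>
    ENNReal.rpow_ne_top_of_nonneg hs.le (dyadicDensity_ne_top hn k x)
  have hPt : ∀ k x, P k x ≠ ⊤ := fun k x => ENNReal.sum_ne_top.2 fun i _ => hat i x
  have haD : ∀ k, (a k).FactorsThrough (dyadicIndex k) := fun k x y hxy => by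
    simp only [ha, factorsThrough_dyadicDensity k hxy]
  have ham : ∀ k, Measurable (a k) := fun k => measurable_of_factorsThrough_dyadicIndex (haD k)
  have hPm : ∀ k, Measurable (P k) := fun k => Finset.measurable_fun_sum _ fun i _ => ham i
  have hMm : Measurable M := Measurable.iSup ham
  have hDD : ∀ j, (D j).FactorsThrough (dyadicIndex j) := by
    intro j x y hxy
    have h1 : P (j + 1) x = P (j + 1) y :=
      factorsThrough_sum_dyadicDensity_rpow (σ := σ) (N := N) s le_rfl hxy
    have h2 : P j x = P j y :=
      factorsThrough_sum_dyadicDensity_rpow (σ := σ) (N := N) s j.le_succ hxy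
    simp only [hD, h1, h2]
  have hDm : ∀ j, Measurable (D j) := fun j => measurable_of_factorsThrough_dyadicIndex (hDD j)
  have hPmono : ∀ x, Monotone fun k => P k x ^ (t - θ) := fun x i j hij =>
    ENNReal.rpow_le_rpow (Finset.sum_le_sum_of_subset (Finset.range_mono hij)) hβ.le
  have hP0 : ∀ x, P 0 x ^ (t - θ) = 0 := fun x => by
    simp [hP, ENNReal.zero_rpow_of_pos hβ]
  have haθ : ∀ k x, a k x ^ θ = dyadicDensity σ N k x ^ η := fun k x => by
    simp only [ha, ← ENNReal.rpow_mul, hη]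
  have hpt : ∀ x k, P k x ^ t ≤ ENNReal.ofReal (t + 1) *
      ∑ i ∈ Finset.range k, ∑ j ∈ Finset.range (i + 1), D j x * a i x ^ θ := by
    intro x k
    induction k with
    | zero => simp [hP, ENNReal.zero_rpow_of_pos ht]
    | succ k ih =>
      have h1 : P (k + 1) x = P k x + a k x := Finset.sum_range_succ _ _
      have h2 : P (k + 1) x ^ (t - θ) ≤ ∑ j ∈ Finset.range (k + 1), D j x :=
        ENNReal.le_sum_range_succ_tsub (fun k => P k x ^ (t - θ)) (hP0 x) (k + 1)
      have h3 := ENNReal.add_rpow_le_rpow_add_mul_s10 ht hθ0 hθ1 (hPt k x) (hat k x)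
      rw [← h1] at h3
      rw [Finset.sum_range_succ, mul_add]
      refine h3.trans (add_le_add ih (mul_le_mul_right ?_ _))
      rw [← Finset.sum_mul, mul_comm]
      exact mul_le_mul_left h2 _
  set I : ℝ≥0∞ := ∫⁻ x in U, P K x ^ t with hI
  set J : ℝ≥0∞ := ∫⁻ x in U, M x ^ t with hJ
  have hIt : I ≠ ⊤ := setLIntegral_sum_dyadicDensity_rpow_ne_top hn hs ht F K
  refine ENNReal.le_rpow_mul_of_le_mul_rpow (by positivity) hIt ?_
  have hgeom : ∀ j, ∑ i ∈ Finset.Ico j K, e ^ (i - j) ≤ G := by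
    intro j
    rw [Finset.sum_Ico_eq_sum_range, hG, ← ENNReal.tsum_geometric]
    simp only [Nat.add_sub_cancel_left]
    exact ENNReal.sum_le_tsum _
  have hterm : ∀ i j, j ≤ i → ∫⁻ x in U, D j x * a i x ^ θ ≤
      (1 + 3 ^ n) * (e ^ (i - j) * ∫⁻ x in U, D j x * a j x ^ θ) := by
    intro i j hij
    simp only [haθ]
    exact setLIntegral_mul_dyadicDensity_rpow_le hn hη0 hθs (hDD j) hij F
  calc I ≤ ∫⁻ x in U, ENNReal.ofReal (t + 1) *
        ∑ i ∈ Finset.range K, ∑ j ∈ Finset.range (i + 1), D j x * a i x ^ θ :=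
        lintegral_mono fun x => hpt x K
    _ = ENNReal.ofReal (t + 1) * ∑ i ∈ Finset.range K, ∑ j ∈ Finset.range (i + 1),
        ∫⁻ x in U, D j x * a i x ^ θ := by
        rw [lintegral_const_mul' _ _ ENNReal.ofReal_ne_top, lintegral_finsetSum]
        · congr 1
          refine Finset.sum_congr rfl fun i _ => lintegral_finsetSum _ fun j _ => ?_
          exact (hDm j).mul ((ham i).pow_const _)
        · exact fun i _ => Finset.measurable_fun_sum _ fun j _ =>
            (hDm j).mul ((ham i).pow_const _)
    _ = ENNReal.ofReal (t + 1) * ∑ j ∈ Finset.range K, ∑ i ∈ Finset.Ico j K,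
        ∫⁻ x in U, D j x * a i x ^ θ := by
        congr 1
        refine Finset.sum_comm' fun i j => ?_
        simp only [Finset.mem_range, Finset.mem_Ico]
        omega
    _ ≤ ENNReal.ofReal (t + 1) * ∑ j ∈ Finset.range K,
        (1 + 3 ^ n) * (G * ∫⁻ x in U, D j x * a j x ^ θ) := by
        gcongr with j hj
        calc _ ≤ ∑ i ∈ Finset.Ico j K, (1 + 3 ^ n) *
              (e ^ (i - j) * ∫⁻ x in U, D j x * a j x ^ θ) :=
              Finset.sum_le_sum fun i hi => hterm i j (Finset.mem_Ico.1 hi).1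
          _ ≤ _ := by
              rw [← Finset.mul_sum, ← Finset.sum_mul]
              gcongr
              exact hgeom j
    _ = c * ∫⁻ x in U, ∑ j ∈ Finset.range K, D j x * a j x ^ θ := by
        have hsum : ∫⁻ x in U, ∑ j ∈ Finset.range K, D j x * a j x ^ θ =
            ∑ j ∈ Finset.range K, ∫⁻ x in U, D j x * a j x ^ θ :=
          lintegral_finsetSum _ fun j _ => (hDm j).mul ((ham j).pow_const _)
        rw [hsum, hc, ← Finset.mul_sum, ← Finset.mul_sum]
        ring
    _ ≤ c * ∫⁻ x in U, (P K x ^ t) ^ (1 - θ / t) * (M x ^ t) ^ (θ / t) := by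
        refine mul_le_mul_right (lintegral_mono fun x => ?_) _
        rw [← ENNReal.rpow_mul, ← ENNReal.rpow_mul, mul_sub, mul_one, mul_div_cancel₀ _ ht.ne']
        calc _ ≤ ∑ j ∈ Finset.range K, D j x * M x ^ θ := by
              gcongr with j _
              exact le_iSup (fun k => a k x) j
          _ ≤ _ := by
              rw [← Finset.sum_mul]
              exact mul_le_mul_left (ENNReal.sum_range_succ_tsub_le _ (hPmono x) K) _
    _ ≤ c * (I ^ (1 - θ / t) * J ^ (θ / t)) := by
        gcongr
        refine ENNReal.lintegral_mul_norm_pow_le ((hPm K).pow_const _).aemeasurable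
          (hMm.pow_const _).aemeasurable ?_ (by positivity) (by ring)
        rw [sub_nonneg, div_le_one ht]
        exact hθt.le

theorem setLIntegral_tsum_dyadicDensity_rpow_lt_top [IsLocallyFiniteMeasure σ] (hn : 1 ≤ n)
    (hN : N < n) {s t : ℝ} (hs : 0 < s) (ht : 0 < t) (F : Finset (Fin n → ℤ))
    (h : ∫⁻ x in {x | dyadicIndex 0 x ∈ (F : Set (Fin n → ℤ))},
      (⨆ k, dyadicDensity σ N k x ^ s) ^ t < ⊤) :
    ∫⁻ x in {x | dyadicIndex 0 x ∈ (F : Set (Fin n → ℤ))},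
      (∑' k, dyadicDensity σ N k x ^ s) ^ t < ⊤ := by
  obtain ⟨C, hC, hle⟩ := exists_setLIntegral_sum_dyadicDensity_rpow_le hn hN hs ht
  refine lt_of_le_of_lt ?_ (ENNReal.mul_lt_top hC.lt_top h)
  have hmono : ∀ x, Monotone fun K => (∑ k ∈ Finset.range K, dyadicDensity σ N k x ^ s) ^ t :=
    fun x i j hij => ENNReal.rpow_le_rpow
      (Finset.sum_le_sum_of_subset (Finset.range_mono hij)) ht.le
  have hsup : ∀ x, (∑' k, dyadicDensity σ N k x ^ s) ^ t =
      ⨆ K, (∑ k ∈ Finset.range K, dyadicDensity σ N k x ^ s) ^ t := by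
    intro x
    have h1 := ENNReal.summable.hasSum.tendsto_sum_nat (f := fun k => dyadicDensity σ N k x ^ s)
    exact tendsto_nhds_unique ((ENNReal.continuous_rpow_const.tendsto _).comp h1)
      (tendsto_atTop_iSup (hmono x))
  simp_rw [hsup]
  rw [lintegral_iSup _ fun i j hij x => hmono x hij]
  · exact iSup_le fun K => hle σ F K
  · intro K
    refine Measurable.pow_const (Finset.measurable_fun_sum _ fun k _ => ?_) _
    exact (measurable_of_factorsThrough_dyadicIndex (factorsThrough_dyadicDensity k)).pow_const _

end MuckenhouptWheeden

section Potentials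

variable {n : ℕ} {α p q : ℝ} {σ : Measure (EuclideanSpace ℝ (Fin n))}

theorem mul_ofReal_sub_le_setLIntegral_Ioi {f : ℝ → ℝ≥0∞} {c : ℝ≥0∞} {a b : ℝ} (ha : 0 ≤ a)
    (hf : ∀ ρ ∈ Ioc a b, c ≤ f ρ) : c * ENNReal.ofReal (b - a) ≤ ∫⁻ ρ in Ioi (0 : ℝ), f ρ :=
  calc c * ENNReal.ofReal (b - a) = ∫⁻ _ in Ioc a b, c := by simp
    _ ≤ ∫⁻ ρ in Ioc a b, f ρ := setLIntegral_mono' measurableSet_Ioc hf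
    _ ≤ _ := lintegral_mono_set fun _ hρ => ha.trans_lt hρ.1

theorem le_wolffPot_dirac (hp : 1 < p) (hN : 0 ≤ n - α * p) {x y : EuclideanSpace ℝ (Fin n)}
    {ρ : ℝ} (hρ : 0 < ρ) (hy : y ∈ ball x ρ) :
    (ENNReal.ofReal (2 * ρ) ^ (n - α * p))⁻¹ ^ (1 / (p - 1)) * 2⁻¹ ≤
      wolffPot n α p (Measure.dirac x) y := by
  have hs : 0 ≤ 1 / (p - 1) := one_div_nonneg.2 (by linarith)
  set b := ENNReal.ofReal (2 * ρ) with hb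
  have hb0 : b ≠ 0 := by simp [hb, hρ]
  have hbt : b ≠ ⊤ := ENNReal.ofReal_ne_top
  have h := mul_ofReal_sub_le_setLIntegral_Ioi (a := ρ) (b := 2 * ρ)
    (c := (b ^ (n - α * p))⁻¹ ^ (1 / (p - 1)) / b) (f := fun τ =>
      (Measure.dirac x (Metric.ball y τ) / ENNReal.ofReal (τ ^ ((n : ℝ) - α * p))) ^
        (1 / (p - 1)) / ENNReal.ofReal τ) hρ.le ?_
  · refine le_trans (le_of_eq ?_) h
    have h2 : ENNReal.ofReal (2 * ρ - ρ) = b * 2⁻¹ := by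
      rw [hb, show 2 * ρ - ρ = 2 * ρ * 2⁻¹ by ring, ENNReal.ofReal_mul (by positivity),
        ENNReal.ofReal_inv_of_pos (by positivity), ENNReal.ofReal_ofNat]
    rw [h2, ← mul_assoc, ENNReal.div_mul_cancel hb0 hbt]
  · intro τ hτ
    have hτ0 : 0 < τ := hρ.trans hτ.1
    have hx : x ∈ ball y τ := by
      rw [mem_ball_comm]; exact ball_subset_ball hτ.1.le hy
    have h3 : ENNReal.ofReal τ ≤ b := ENNReal.ofReal_le_ofReal hτ.2
    rw [Measure.dirac_apply_of_mem hx, one_div (ENNReal.ofReal _),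
      ← ENNReal.ofReal_rpow_of_pos hτ0]
    gcongr

theorem le_embC_ball (hp : 1 < p) (hq : 0 < q) (hN : 0 ≤ n - α * p)
    {x : EuclideanSpace ℝ (Fin n)} {ρ : ℝ} (hρ : 0 < ρ) :
    (ENNReal.ofReal (2 * ρ) ^ (n - α * p))⁻¹ ^ (1 / (p - 1)) * 2⁻¹ * σ (ball x ρ) ^ (1 / q) ≤
      embC n α p q σ (ball x ρ) := by
  refine le_sInf fun κ hκ => ?_
  have h := hκ (Measure.dirac x) inferInstance
  rw [measure_univ, ENNReal.one_rpow, mul_one] at h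
  refine le_trans ?_ h
  set c := (ENNReal.ofReal (2 * ρ) ^ (n - α * p))⁻¹ ^ (1 / (p - 1)) * 2⁻¹ with hc
  calc c * σ (ball x ρ) ^ (1 / q) = (c ^ q * σ (ball x ρ)) ^ (1 / q) := by
        rw [ENNReal.mul_rpow_of_nonneg _ _ (by positivity), ← ENNReal.rpow_mul,
          mul_one_div_cancel hq.ne', ENNReal.rpow_one]
    _ = (∫⁻ _ in ball x ρ, c ^ q ∂σ) ^ (1 / q) := by rw [setLIntegral_const]
    _ ≤ _ := by
        refine ENNReal.rpow_le_rpow (setLIntegral_mono' measurableSet_ball fun y hy => ?_)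
          (by positivity)
        exact ENNReal.rpow_le_rpow (le_wolffPot_dirac hp hN hρ hy) hq.le

theorem exists_mul_le_embC_rpow_div (hp : 1 < p) (hq : 0 < q) (hqp : q < p - 1)
    (hN : 0 ≤ n - α * p) :
    ∃ c : ℝ≥0∞, c ≠ 0 ∧ ∀ (σ : Measure (EuclideanSpace ℝ (Fin n))) (x : EuclideanSpace ℝ (Fin n))
      (ρ : ℝ), 0 < ρ →
      c * (σ (ball x ρ) / ENNReal.ofReal ρ ^ (n - α * p)) ^ ((p - 1) / (p - 1 - q)) ≤
      embC n α p q σ (ball x ρ) ^ (q * (p - 1) / (p - 1 - q)) /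
        ENNReal.ofReal ρ ^ (n - α * p) := by
  have hd : 0 < p - 1 - q := by linarith
  have hp1 : 0 < p - 1 := by linarith
  set N := n - α * p with hNdef
  set g := (p - 1) / (p - 1 - q) with hg
  have hg0 : 0 < g := by positivity
  have hqg : q * (p - 1) / (p - 1 - q) = q * g := by rw [hg]; ring
  have hqg0 : 0 < q * g := by positivity
  refine ⟨((2 ^ N : ℝ≥0∞)⁻¹ ^ (1 / (p - 1)) * 2⁻¹) ^ (q * g), ?_, ?_⟩
  · have h2 : (2 ^ N : ℝ≥0∞) ≠ ⊤ := ENNReal.rpow_ne_top_of_ne_zero (by simp) (by simp)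
    have h2' : (2 ^ N : ℝ≥0∞) ≠ 0 := by simp [ENNReal.rpow_eq_zero_iff]
    have h3 : (2 ^ N : ℝ≥0∞)⁻¹ ^ (1 / (p - 1)) ≠ 0 :=
      ENNReal.rpow_ne_zero_of_ne_zero_of_ne_top (ENNReal.inv_ne_zero.2 h2)
        (ENNReal.inv_ne_top.2 h2') _
    have h4 : (2 ^ N : ℝ≥0∞)⁻¹ ^ (1 / (p - 1)) ≠ ⊤ :=
      ENNReal.rpow_ne_top_of_nonneg (by positivity) (ENNReal.inv_ne_top.2 h2')
    have h5 : (2 ^ N : ℝ≥0∞)⁻¹ ^ (1 / (p - 1)) * 2⁻¹ ≠ 0 := mul_ne_zero h3 (by simp)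
    have h6 : (2 ^ N : ℝ≥0∞)⁻¹ ^ (1 / (p - 1)) * 2⁻¹ ≠ ⊤ := ENNReal.mul_ne_top h4 (by simp)
    exact ENNReal.rpow_ne_zero_of_ne_zero_of_ne_top h5 h6 _
  · intro σ x ρ hρ
    rw [hqg]
    have h := ENNReal.rpow_le_rpow (le_embC_ball (σ := σ) (x := x) hp hq hN hρ) hqg0.le
    rw [← hNdef, ENNReal.ofReal_mul (by norm_num), ENNReal.ofReal_ofNat] at h
    set b := ENNReal.ofReal ρ with hb
    have hb0 : b ≠ 0 := by simp [hb, hρ]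
    have hbt : b ≠ ⊤ := ENNReal.ofReal_ne_top
    have hB0 : b ^ N ≠ 0 := by simp [ENNReal.rpow_eq_zero_iff, hb0, hbt]
    have hBt : b ^ N ≠ ⊤ := ENNReal.rpow_ne_top_of_ne_zero hb0 hbt
    refine le_trans (le_of_eq ?_) (ENNReal.div_le_div_right h _)
    set B := b ^ N with hB
    have e1 : ((2 * b) ^ N)⁻¹ = (2 ^ N : ℝ≥0∞)⁻¹ * B⁻¹ := by
      rw [ENNReal.mul_rpow_of_nonneg _ _ hN, ENNReal.mul_inv (Or.inr hBt) (Or.inr hB0)]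
    have e2 : (B⁻¹ ^ (1 / (p - 1))) ^ (q * g) * B⁻¹ = B⁻¹ ^ g := by
      conv_lhs => rw [← ENNReal.rpow_mul]
      nth_rw 2 [← ENNReal.rpow_one B⁻¹]
      rw [← ENNReal.rpow_add _ _ (ENNReal.inv_ne_zero.2 hBt) (ENNReal.inv_ne_top.2 hB0)]
      congr 1
      rw [hg]; field_simp; ring
    have e3 : (σ (ball x ρ) ^ (1 / q)) ^ (q * g) = σ (ball x ρ) ^ g := by
      rw [← ENNReal.rpow_mul]; congr 1; field_simp
    rw [e1, ENNReal.mul_rpow_of_nonneg _ _ (by positivity : 0 ≤ 1 / (p - 1)), div_eq_mul_inv,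
      div_eq_mul_inv, ENNReal.mul_rpow_of_nonneg _ _ hg0.le, ← e2, ← e3]
    simp only [ENNReal.mul_rpow_of_nonneg _ _ hqg0.le]
    rw [div_eq_mul_inv (_ : ℝ≥0∞) B]
    ring_nf

theorem exists_dyadicDensity_rpow_le_mul_intK (hn : 1 ≤ n) (hp : 1 < p) (hq : 0 < q)
    (hqp : q < p - 1) (hN : 0 ≤ n - α * p) :
    ∃ C : ℝ≥0∞, C ≠ ⊤ ∧ ∀ (σ : Measure (EuclideanSpace ℝ (Fin n))) (k : ℕ)
      (x : EuclideanSpace ℝ (Fin n)),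
      (dyadicDensity σ (n - α * p) k x ^ (1 / (p - 1))) ^ ((p - 1) / (p - 1 - q)) ≤
        C * intK n α p q σ x := by
  obtain ⟨c, hc0, hc⟩ := exists_mul_le_embC_rpow_div hp hq hqp hN
  have hd : 0 < p - 1 - q := by linarith
  have hp1 : 0 < p - 1 := by linarith
  set N := n - α * p with hNdef
  set g := (p - 1) / (p - 1 - q) with hg
  have hg0 : 0 < g := by positivity
  have hs0 : 0 < 1 / (p - 1) := by positivity
  set s := 1 / (p - 1) with hs
  have hn0 : (0 : ℝ) < n := by exact_mod_cast hn
  set A : ℝ≥0∞ := ENNReal.ofReal (4 * n) ^ N with hA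
  have hA0 : A ≠ 0 := 
    ENNReal.rpow_ne_zero_of_ne_zero_of_ne_top
      (ENNReal.ofReal_pos.2 (by positivity)).ne' ENNReal.ofReal_ne_top _
  have hAt : A ≠ ⊤ := ENNReal.rpow_ne_top_of_nonneg hN ENNReal.ofReal_ne_top
  set c' : ℝ≥0∞ := min c 1 with hc'
  have hc'0 : c' ≠ 0 := by simp [hc', hc0]
  have hc't : c' ≠ ⊤ := ne_top_of_le_ne_top ENNReal.one_ne_top (min_le_right _ _)
  set L : ℝ≥0∞ := (c' * A⁻¹ ^ g) ^ s * 2⁻¹ with hL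
  have hAg0 : A⁻¹ ^ g ≠ 0 :=
    ENNReal.rpow_ne_zero_of_ne_zero_of_ne_top (ENNReal.inv_ne_zero.2 hAt)
      (ENNReal.inv_ne_top.2 hA0) _
  have hAgt : A⁻¹ ^ g ≠ ⊤ :=
    ENNReal.rpow_ne_top_of_nonneg hg0.le (ENNReal.inv_ne_top.2 hA0)
  have hL1 : c' * A⁻¹ ^ g ≠ 0 := mul_ne_zero hc'0 hAg0
  have hL2 : c' * A⁻¹ ^ g ≠ ⊤ := ENNReal.mul_ne_top hc't hAgt
  have hL0 : L ≠ 0 :=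
    mul_ne_zero (ENNReal.rpow_ne_zero_of_ne_zero_of_ne_top hL1 hL2 _) (by simp)
  have hLt : L ≠ ⊤ :=
    ENNReal.mul_ne_top (ENNReal.rpow_ne_top_of_nonneg hs0.le hL2) (by simp)
  refine ⟨L⁻¹, ENNReal.inv_ne_top.2 hL0, fun σ k x => ?_⟩
  rw [mul_comm, ← div_eq_mul_inv, ENNReal.le_div_iff_mul_le (Or.inl hL0) (Or.inl hLt)]
  set d : ℝ := 2 * n / 2 ^ k with hddef
  have hd0 : 0 < d := by positivity
  set b : ℝ≥0∞ := ENNReal.ofReal (2 * d) with hb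
  have hb0 : b ≠ 0 := by simp [hb, hd0]
  have hbt : b ≠ ⊤ := ENNReal.ofReal_ne_top
  have hbN : b ^ N = A * (2 ^ (k * N))⁻¹ := by
    have : b = ENNReal.ofReal (4 * n) * (2 ^ (k : ℝ))⁻¹ := by
      rw [hb, hddef, show 2 * (2 * n / 2 ^ k : ℝ) = 4 * n * (2 ^ k)⁻¹ by ring,
        ENNReal.ofReal_mul (by positivity), ENNReal.ofReal_inv_of_pos (by positivity),
        ENNReal.ofReal_pow (by norm_num), ENNReal.ofReal_ofNat, ENNReal.rpow_natCast]
    rw [this, ENNReal.mul_rpow_of_nonneg _ _ hN, ENNReal.inv_rpow, ← ENNReal.rpow_mul]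
  have h := mul_ofReal_sub_le_setLIntegral_Ioi (a := d) (b := 2 * d)
    (c := (c' * (A⁻¹ * dyadicDensity σ N k x) ^ g) ^ s / b) (f := fun ρ =>
      (embC n α p q σ (Metric.ball x ρ) ^ (q * (p - 1) / (p - 1 - q)) /
        ENNReal.ofReal (ρ ^ ((n : ℝ) - α * p))) ^ (1 / (p - 1)) / ENNReal.ofReal ρ) hd0.le ?_
  · refine le_trans (le_of_eq ?_) h
    have h2 : ENNReal.ofReal (2 * d - d) = b * 2⁻¹ := by
      rw [hb, show 2 * d - d = 2 * d * 2⁻¹ by ring, ENNReal.ofReal_mul (by positivity),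
        ENNReal.ofReal_inv_of_pos (by positivity), ENNReal.ofReal_ofNat]
    rw [h2, ← mul_assoc (_ / b) b, ENNReal.div_mul_cancel hb0 hbt, hL]
    simp only [ENNReal.mul_rpow_of_nonneg _ _ hg0.le, ENNReal.mul_rpow_of_nonneg _ _ hs0.le]
    rw [← ENNReal.rpow_mul (dyadicDensity σ N k x), ← ENNReal.rpow_mul (dyadicDensity σ N k x),
      mul_comm s g]
    ring
  · intro ρ hρ
    have hρ0 : 0 < ρ := hd0.trans hρ.1
    have h3 : ENNReal.ofReal ρ ≤ b := ENNReal.ofReal_le_ofReal hρ.2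
    have h4 : A⁻¹ * dyadicDensity σ N k x ≤ σ (ball x ρ) / ENNReal.ofReal ρ ^ N := by
      calc A⁻¹ * dyadicDensity σ N k x = σ (dyadicNhd k x) / b ^ N := by
            rw [hbN, div_eq_mul_inv, ENNReal.mul_inv (Or.inl hA0) (Or.inl hAt), inv_inv,
              dyadicDensity]
            ring
        _ ≤ _ := by
            gcongr
            exact (dyadicNhd_subset_ball hn k x).trans (ball_subset_ball hρ.1.le)
    rw [← ENNReal.ofReal_rpow_of_pos hρ0]
    refine ENNReal.div_le_div (ENNReal.rpow_le_rpow ?_ hs0.le) h3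
    refine le_trans ?_ (hc σ x ρ hρ0)
    gcongr
    exact min_le_left _ _

theorem setLIntegral_Ioc_wolff_le_tsum_dyadicDensity (hp : 1 < p) (hN : 0 ≤ n - α * p)
    (x : EuclideanSpace ℝ (Fin n)) :
    ∫⁻ ρ in Ioc (0 : ℝ) 1, (σ (ball x ρ) / ENNReal.ofReal (ρ ^ ((n : ℝ) - α * p))) ^
        (1 / (p - 1)) / ENNReal.ofReal ρ ≤
      (2 ^ (n - α * p)) ^ (1 / (p - 1)) *
        ∑' k, dyadicDensity σ (n - α * p) k x ^ (1 / (p - 1)) := by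
  have hs0 : 0 ≤ 1 / (p - 1) := one_div_nonneg.2 (by linarith)
  set N := n - α * p with hNdef
  set s := 1 / (p - 1) with hs
  have hcover : Ioc (0 : ℝ) 1 ⊆ ⋃ k : ℕ, Ioc (((2 : ℝ) ^ (k + 1))⁻¹) ((2 ^ k)⁻¹) := by
    intro ρ hρ
    obtain ⟨k, hk1, hk2⟩ := exists_nat_pow_near_of_lt_one hρ.1 hρ.2
      (by norm_num : (0 : ℝ) < 1 / 2) (by norm_num)
    refine mem_iUnion.2 ⟨k, ?_, ?_⟩
    · simpa using hk1
    · simpa using hk2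
  rw [← ENNReal.tsum_mul_left]
  refine (lintegral_mono_set hcover).trans ((lintegral_iUnion_le _ _).trans ?_)
  refine ENNReal.tsum_le_tsum fun k => ?_
  set b : ℝ≥0∞ := ENNReal.ofReal ((2 ^ (k + 1))⁻¹) with hb
  have hb0 : b ≠ 0 := by rw [hb]; simp
  have hbt : b ≠ ⊤ := ENNReal.ofReal_ne_top
  have hbN : (b ^ N)⁻¹ = 2 ^ N * 2 ^ (k * N) := by
    rw [hb, ENNReal.ofReal_inv_of_pos (by positivity), ENNReal.ofReal_pow (by norm_num),
      ENNReal.ofReal_ofNat, ← ENNReal.inv_rpow, inv_inv, ← ENNReal.rpow_natCast,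
      ← ENNReal.rpow_mul, ← ENNReal.rpow_add _ _ (by simp) (by simp)]
    congr 1; push_cast; ring
  calc _ ≤ ∫⁻ _ in Ioc (((2 : ℝ) ^ (k + 1))⁻¹) ((2 ^ k)⁻¹),
        (2 ^ N * dyadicDensity σ N k x) ^ s / b := by
        refine setLIntegral_mono' measurableSet_Ioc fun ρ hρ => ?_
        have hρ0 : 0 < ρ := lt_trans (by positivity) hρ.1
        have h3 : b ≤ ENNReal.ofReal ρ := ENNReal.ofReal_le_ofReal hρ.1.le
        rw [← ENNReal.ofReal_rpow_of_pos hρ0]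
        refine ENNReal.div_le_div (ENNReal.rpow_le_rpow ?_ hs0) h3
        calc _ ≤ σ (dyadicNhd k x) / b ^ N := by
              gcongr
              refine (ball_subset_ball hρ.2).trans ?_
              rw [← one_div]
              exact ball_subset_dyadicNhd k x
          _ = _ := by rw [div_eq_mul_inv, hbN, dyadicDensity]; ring
    _ = (2 ^ N * dyadicDensity σ N k x) ^ s / b * b := by
        rw [setLIntegral_const, Real.volume_Ioc]
        congr 2
        rw [pow_succ]; field_simp; norm_num
    _ = _ := by
        rw [ENNReal.div_mul_cancel hb0 hbt, ENNReal.mul_rpow_of_nonneg _ _ hs0]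

theorem setLIntegral_Ioi_comp_mul_left (f : ℝ → ℝ≥0∞) {c : ℝ} (hc : 0 < c) :
    ENNReal.ofReal c * ∫⁻ ρ in Ioi (1 : ℝ), f (c * ρ) = ∫⁻ ρ in Ioi c, f ρ := by
  have hemb : MeasurableEmbedding fun ρ : ℝ => c * ρ := measurableEmbedding_mulLeft₀ hc.ne'
  have h := Real.smul_map_volume_mul_left hc.ne'
  rw [abs_of_pos hc] at h
  conv_rhs => rw [← h, Measure.restrict_smul, lintegral_smul_measure, hemb.restrict_map,
    hemb.lintegral_map]
  have : (fun ρ : ℝ => c * ρ) ⁻¹' Ioi c = Ioi 1 := by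
    ext ρ; simp [lt_mul_iff_one_lt_right hc]
  rw [this, smul_eq_mul]

theorem setLIntegral_Ioi_wolff_le (hp : 1 < p) (hN : 0 ≤ n - α * p) {R : ℝ} (hR : 0 < R)
    {x : EuclideanSpace ℝ (Fin n)} (hx : x ∈ ball (0 : EuclideanSpace ℝ (Fin n)) R) :
    ∫⁻ ρ in Ioi (1 : ℝ), (σ (ball x ρ) / ENNReal.ofReal (ρ ^ ((n : ℝ) - α * p))) ^
        (1 / (p - 1)) / ENNReal.ofReal ρ ≤
      (ENNReal.ofReal (1 + R) ^ (n - α * p)) ^ (1 / (p - 1)) *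
        ∫⁻ ρ in Ioi (1 : ℝ), (σ (ball 0 ρ) / ENNReal.ofReal (ρ ^ ((n : ℝ) - α * p))) ^
          (1 / (p - 1)) / ENNReal.ofReal ρ := by
  have hs0 : 0 ≤ 1 / (p - 1) := one_div_nonneg.2 (by linarith)
  set N := n - α * p with hNdef
  set s := 1 / (p - 1) with hs
  set c := ENNReal.ofReal (1 + R) with hc
  have hc0 : c ≠ 0 := by rw [hc]; simp; linarith
  have hct : c ≠ ⊤ := ENNReal.ofReal_ne_top
  have hcN0 : c ^ N ≠ 0 := by simp [ENNReal.rpow_eq_zero_iff, hc0, hct]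
  have hcNt : c ^ N ≠ ⊤ := ENNReal.rpow_ne_top_of_nonneg hN hct
  have hcst : (c ^ N) ^ s ≠ ⊤ := ENNReal.rpow_ne_top_of_nonneg hs0 hcNt
  set f : ℝ → ℝ≥0∞ := fun ρ => (σ (ball 0 ρ) / ENNReal.ofReal (ρ ^ N)) ^ s / ENNReal.ofReal ρ
    with hf
  have hpt : ∀ ρ ∈ Ioi (1 : ℝ), (σ (ball x ρ) / ENNReal.ofReal (ρ ^ N)) ^ s / ENNReal.ofReal ρ ≤
      (c ^ N) ^ s * c * f ((1 + R) * ρ) := by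
    intro ρ hρ
    have hρ1 : 1 < ρ := hρ
    have hρ0 : 0 < ρ := by linarith
    have hsub : ball x ρ ⊆ ball 0 ((1 + R) * ρ) := by
      refine ball_subset_ball' ?_
      rw [mem_ball] at hx
      nlinarith
    set b := ENNReal.ofReal ρ with hb
    have hb0 : b ≠ 0 := by simp [hb, hρ0]
    have hbt : b ≠ ⊤ := ENNReal.ofReal_ne_top
    simp only [hf]
    rw [← ENNReal.ofReal_rpow_of_pos hρ0, ← ENNReal.ofReal_rpow_of_pos (by positivity),
      ENNReal.ofReal_mul (by positivity), ← hb, ← hc, ENNReal.mul_rpow_of_nonneg _ _ hN]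
    have e1 : σ (ball 0 ((1 + R) * ρ)) / (c ^ N * b ^ N) =
        (c ^ N)⁻¹ * (σ (ball 0 ((1 + R) * ρ)) / b ^ N) := by
      rw [div_eq_mul_inv, ENNReal.mul_inv (Or.inl hcN0) (Or.inl hcNt), div_eq_mul_inv]; ring
    have e2 : ∀ z : ℝ≥0∞, (c ^ N) ^ s * c * (((c ^ N)⁻¹ ^ s * z) / (c * b)) = z / b := by
      intro z
      have h0 : (c ^ N) ^ s ≠ 0 :=
        ENNReal.rpow_ne_zero_of_ne_zero_of_ne_top hcN0 hcNt _
      rw [div_eq_mul_inv, ENNReal.mul_inv (Or.inl hc0) (Or.inl hct), ENNReal.inv_rpow]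
      calc _ = ((c ^ N) ^ s * ((c ^ N) ^ s)⁻¹) * (c * c⁻¹) * (z * b⁻¹) := by ring
        _ = _ := by
          rw [ENNReal.mul_inv_cancel h0 hcst, ENNReal.mul_inv_cancel hc0 hct, one_mul, one_mul,
            div_eq_mul_inv]
    rw [e1, ENNReal.mul_rpow_of_nonneg _ _ hs0, e2]
    gcongr
  calc _ ≤ ∫⁻ ρ in Ioi (1 : ℝ), (c ^ N) ^ s * c * f ((1 + R) * ρ) :=
        setLIntegral_mono' measurableSet_Ioi hpt
    _ = (c ^ N) ^ s * ∫⁻ ρ in Ioi (1 + R), f ρ := by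
        rw [lintegral_const_mul' _ _ (ENNReal.mul_ne_top hcst hct), mul_assoc,
          setLIntegral_Ioi_comp_mul_left f (by positivity)]
    _ ≤ _ := mul_le_mul_right (lintegral_mono_set (Ioi_subset_Ioi (by linarith))) _

end Potentials

theorem exists_finset_ball_subset_dyadicIndex_mem {n : ℕ} (hn : 1 ≤ n) {R : ℝ} (hR : 0 < R) :
    ∃ (F : Finset (Fin n → ℤ)) (R' : ℝ), 0 < R' ∧
      ball 0 R ⊆ {x : EuclideanSpace ℝ (Fin n) | dyadicIndex 0 x ∈ (F : Set (Fin n → ℤ))} ∧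
      {x : EuclideanSpace ℝ (Fin n) | dyadicIndex 0 x ∈ (F : Set (Fin n → ℤ))} ⊆ ball 0 R' := by
  have hn0 : (0 : ℝ) < n := by exact_mod_cast hn
  have hM : (0 : ℝ) < ⌈R⌉ := hR.trans_le (Int.le_ceil R)
  refine ⟨Finset.Icc (fun _ => -⌈R⌉) (fun _ => ⌈R⌉), n * (⌈R⌉ + 1), by positivity, ?_, ?_⟩
  · intro x hx
    have hxi : ∀ i, |x i| < R := fun i =>
      lt_of_le_of_lt (by simpa using PiLp.norm_apply_le x i) (mem_ball_zero_iff.1 hx)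
    have hceil := Int.le_ceil R
    simp only [mem_ofPred_eq, Finset.coe_Icc, mem_Icc, Pi.le_def, dyadicIndex, pow_zero, one_mul]
    refine ⟨fun i => Int.le_floor.2 ?_, fun i => ?_⟩
    · have := (abs_lt.1 (hxi i)).1
      push_cast
      linarith
    · have h1 := (abs_lt.1 (hxi i)).2
      have h2 : (⌊x i⌋ : ℝ) ≤ ⌈R⌉ := (Int.floor_le (x i)).trans (by linarith)
      exact_mod_cast h2
  · intro x hx
    simp only [mem_ofPred_eq, Finset.coe_Icc, mem_Icc, Pi.le_def, dyadicIndex, pow_zero,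
      one_mul] at hx
    rw [mem_ball_zero_iff]
    refine norm_lt_of_forall_abs_lt hn fun i => ?_
    have h1 : (-⌈R⌉ : ℝ) ≤ ⌊x i⌋ := by exact_mod_cast hx.1 i
    have h2 : (⌊x i⌋ : ℝ) ≤ ⌈R⌉ := by exact_mod_cast hx.2 i
    have h3 := Int.floor_le (x i)
    have h4 := Int.lt_floor_add_one (x i)
    rw [abs_lt]
    constructor <;> linarith

theorem ENNReal.add_rpow_le_two_rpow_mul {a b : ℝ≥0∞} {t : ℝ} (ht : 0 ≤ t) :
    (a + b) ^ t ≤ 2 ^ t * (a ^ t + b ^ t) := by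
  rcases le_total a b with h | h
  · calc (a + b) ^ t ≤ (2 * b) ^ t := by rw [two_mul]; gcongr
      _ = 2 ^ t * b ^ t := ENNReal.mul_rpow_of_nonneg _ _ ht
      _ ≤ _ := by gcongr; exact le_add_self
  · calc (a + b) ^ t ≤ (2 * a) ^ t := by rw [two_mul]; gcongr
      _ = 2 ^ t * a ^ t := ENNReal.mul_rpow_of_nonneg _ _ ht
      _ ≤ _ := by gcongr; exact le_self_add

theorem setLIntegral_iSup_dyadicDensity_rpow_lt_top {n : ℕ} {α p q r : ℝ} (hn : 1 ≤ n)
    (hp : 1 < p) (hq : 0 < q) (hqp : q < p - 1) (hN : 0 ≤ n - α * p) (hr : 0 < r)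
    {σ : Measure (EuclideanSpace ℝ (Fin n))} {U : Set (EuclideanSpace ℝ (Fin n))}
    (hK : ∫⁻ x in U, intK n α p q σ x ^ r < ⊤) :
    ∫⁻ x in U, (⨆ k, dyadicDensity σ (n - α * p) k x ^ (1 / (p - 1))) ^
      (r * (p - 1) / (p - 1 - q)) < ⊤ := by
  obtain ⟨C, hCt, hC⟩ := exists_dyadicDensity_rpow_le_mul_intK (α := α) hn hp hq hqp hN
  have hd : 0 < p - 1 - q := by linarith
  have hp1 : 0 < p - 1 := by linarith
  set g := (p - 1) / (p - 1 - q) with hg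
  have hg0 : 0 < g := by positivity
  have hrg : r * (p - 1) / (p - 1 - q) = g * r := by rw [hg]; ring
  have hpt : ∀ x, (⨆ k, dyadicDensity σ (n - α * p) k x ^ (1 / (p - 1))) ^
      (r * (p - 1) / (p - 1 - q)) ≤ C ^ r * intK n α p q σ x ^ r := by
    intro x
    rw [hrg, ENNReal.rpow_mul, ← ENNReal.mul_rpow_of_nonneg _ _ hr.le]
    refine ENNReal.rpow_le_rpow ?_ hr.le
    rw [← ENNReal.le_rpow_inv_iff hg0]
    exact iSup_le fun k => (ENNReal.le_rpow_inv_iff hg0).2 (hC σ k x)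
  have hCr : C ^ r ≠ ⊤ := ENNReal.rpow_ne_top_of_nonneg hr.le hCt
  calc _ ≤ ∫⁻ x in U, C ^ r * intK n α p q σ x ^ r := lintegral_mono hpt
    _ = C ^ r * ∫⁻ x in U, intK n α p q σ x ^ r := lintegral_const_mul' _ _ hCr
    _ < ⊤ := ENNReal.mul_lt_top hCr.lt_top hK

/-- For `r ≥ n(p−1)/(n−αp)`: if `∫₁^∞ (σ(B(0,ρ))/ρ^{n−αp})^{1/(p−1)} dρ/ρ < ∞` and
`K_{α,p,q}σ ∈ L^r_loc(ℝⁿ)`, then `W_{α,p}σ ∈ L^{r(p−1)/(p−1−q)}_loc(ℝⁿ)`. -/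
theorem wolff_mem_Lr_loc_of_intK_mem_Lr_loc (n : ℕ) (hn : 1 ≤ n) (α p q r : ℝ)
    (hp : 1 < p) (hq0 : 0 < q) (hqp : q < p - 1)
    (hα0 : 0 < α) (hαp : α < n / p)
    (hr : (n : ℝ) * (p - 1) / ((n : ℝ) - α * p) ≤ r)
    (σ : Measure (EuclideanSpace ℝ (Fin n))) (hσloc : IsLocallyFiniteMeasure σ)
    (hfin : (∫⁻ ρ in Set.Ioi (1 : ℝ),
      (σ (Metric.ball (0 : EuclideanSpace ℝ (Fin n)) ρ) /
          ENNReal.ofReal (ρ ^ ((n : ℝ) - α * p))) ^ (1 / (p - 1)) /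
        ENNReal.ofReal ρ) < ⊤)
    (hK : ∀ R : ℝ, 0 < R →
      (∫⁻ x in Metric.ball (0 : EuclideanSpace ℝ (Fin n)) R, intK n α p q σ x ^ r) < ⊤) :
    ∀ R : ℝ, 0 < R →
      (∫⁻ x in Metric.ball (0 : EuclideanSpace ℝ (Fin n)) R,
        wolffPot n α p σ x ^ (r * (p - 1) / (p - 1 - q))) < ⊤ := by
  intro R hR
  have hn0 : (0 : ℝ) < n := by exact_mod_cast hn
  have hd : 0 < p - 1 - q := by linarith
  have hp1 : 0 < p - 1 := by linarith
  have hN : 0 < n - α * p := by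
    rw [lt_div_iff₀ (by linarith)] at hαp
    linarith
  have hNn : n - α * p < n := by
    have : 0 < α * p := by positivity
    linarith
  have hr0 : 0 < r := lt_of_lt_of_le (by positivity) hr
  have hs : 0 < 1 / (p - 1) := by positivity
  have ht : 0 < r * (p - 1) / (p - 1 - q) := by positivity
  obtain ⟨F, R', hR', hRF, hFR'⟩ := exists_finset_ball_subset_dyadicIndex_mem hn hR
  have hS := setLIntegral_tsum_dyadicDensity_rpow_lt_top hn hNn hs ht F
    (setLIntegral_iSup_dyadicDensity_rpow_lt_top (σ := σ) hn hp hq0 hqp hN.le hr0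
      ((lintegral_mono_set hFR').trans_lt (hK R' hR')))
  set t := r * (p - 1) / (p - 1 - q) with htdef
  set A : ℝ≥0∞ := (2 ^ (n - α * p)) ^ (1 / (p - 1)) with hA
  set B : ℝ≥0∞ := (ENNReal.ofReal (1 + R) ^ (n - α * p)) ^ (1 / (p - 1)) *
    ∫⁻ ρ in Ioi (1 : ℝ), (σ (ball 0 ρ) / ENNReal.ofReal (ρ ^ ((n : ℝ) - α * p))) ^
      (1 / (p - 1)) / ENNReal.ofReal ρ with hB
  have hAt : A ^ t ≠ ⊤ := ENNReal.rpow_ne_top_of_nonneg ht.le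
    (ENNReal.rpow_ne_top_of_nonneg hs.le (ENNReal.rpow_ne_top_of_nonneg hN.le (by simp)))
  have hBt : B ^ t < ⊤ := ENNReal.rpow_lt_top_of_nonneg ht.le
    (ENNReal.mul_ne_top (ENNReal.rpow_ne_top_of_nonneg hs.le
      (ENNReal.rpow_ne_top_of_nonneg hN.le ENNReal.ofReal_ne_top)) hfin.ne)
  have h2t : (2 : ℝ≥0∞) ^ t ≠ ⊤ := ENNReal.rpow_ne_top_of_nonneg ht.le (by simp)
  have hpt : ∀ x ∈ ball (0 : EuclideanSpace ℝ (Fin n)) R, wolffPot n α p σ x ^ t ≤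
      2 ^ t * (A ^ t * (∑' k, dyadicDensity σ (n - α * p) k x ^ (1 / (p - 1))) ^ t + B ^ t) := by
    intro x hx
    rw [← ENNReal.mul_rpow_of_nonneg _ _ ht.le]
    refine le_trans (ENNReal.rpow_le_rpow ?_ ht.le) (ENNReal.add_rpow_le_two_rpow_mul ht.le)
    rw [wolffPot, ← Ioc_union_Ioi_eq_Ioi (zero_le_one' ℝ)]
    exact (lintegral_union_le _ _ _).trans (add_le_add
      (setLIntegral_Ioc_wolff_le_tsum_dyadicDensity hp hN.le x)
      (setLIntegral_Ioi_wolff_le hp hN.le hR hx))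
  refine (setLIntegral_mono' measurableSet_ball hpt).trans_lt ?_
  rw [lintegral_const_mul' _ _ h2t, lintegral_add_right _ measurable_const,
    lintegral_const_mul' _ _ hAt, setLIntegral_const]
  exact ENNReal.mul_lt_top h2t.lt_top (ENNReal.add_lt_top.2
    ⟨ENNReal.mul_lt_top hAt.lt_top ((lintegral_mono_set hRF).trans_lt hS),
      ENNReal.mul_lt_top hBt measure_ball_lt_top⟩)
end
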